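/- (Conjecture.) Fix an integer k > 1 and an integer n ≥ κ, and let ν = n − ⌊(k+4)/8⌋. Then α_{k,n} − n ∈ (0,1); that is, there exists λ > 0 with n < κλ < n + 1 such that Σ_{j=0}^{ν} f_k(j;λ) = 1/2 exactly. -/

import Mathlib

open scoped BigOperators

/-- The pmf of the Poisson distribution of order `k` with parameter `lam`:
`f_k(n;λ) = e^{-kλ} Σ_{n₁+2n₂+⋯+k n_k = n} λ^{n₁+⋯+n_k}/(n₁!⋯n_k!)`. -/
noncomputable def poissonOrderKPmf (k : ℕ) (lam : ℝ) (n : ℕ) : ℝ :=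
  Real.exp (-(k * lam)) *
    ∑' v : Fin k → ℕ,
      if (∑ i : Fin k, ((i : ℕ) + 1) * v i) = n then
        lam ^ (∑ i : Fin k, v i) / ((∏ i : Fin k, Nat.factorial (v i) : ℕ) : ℝ)
      else 0

/-- The median of the Poisson distribution of order `k` with parameter `lam`:
the least integer `n` such that `P(X ≤ n) ≥ 1/2`. -/
noncomputable def poissonOrderKMedian (k : ℕ) (lam : ℝ) : ℕ :=
  sInf {n : ℕ | (1 : ℝ) / 2 ≤ ∑ j ∈ Finset.range (n + 1), poissonOrderKPmf k lam j}

/-- The sum over compositions in the definition of `poissonOrderKPmf`. -/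
noncomputable def orderKCoeff (k : ℕ) (lam : ℝ) (n : ℕ) : ℝ :=
  ∑' v : Fin k → ℕ,
    if (∑ i : Fin k, ((i : ℕ) + 1) * v i) = n then
      lam ^ (∑ i : Fin k, v i) / ((∏ i : Fin k, Nat.factorial (v i) : ℕ) : ℝ)
    else 0

theorem hasSum_prod_fin (k : ℕ) (f : Fin k → ℕ → ℂ) (a : Fin k → ℂ)
    (hs : ∀ i, Summable fun n => ‖f i n‖) (hf : ∀ i, HasSum (f i) (a i)) :
    HasSum (fun v : Fin k → ℕ => ∏ i, f i (v i)) (∏ i, a i) ∧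
      Summable fun v : Fin k → ℕ => ‖∏ i, f i (v i)‖ := by
  induction k with
  | zero => exact ⟨by simp [hasSum_unique],
      Summable.of_finite⟩
  | succ k ih =>
    obtain ⟨h1, h2⟩ := ih (fun i => f i.succ) (fun i => a i.succ) (fun i => hs _) (fun i => hf _)
    have h3 := Summable.mul_norm (hs 0) h2
    rw [← (Fin.consEquiv fun _ : Fin (k + 1) => ℕ).hasSum_iff,
      ← (Fin.consEquiv fun _ : Fin (k + 1) => ℕ).summable_iff]
    refine ⟨?_, ?_⟩
    · have := (hf 0).mul h1 h3.of_norm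
      have e : (fun v : Fin (k + 1) → ℕ => ∏ i, f i (v i)) ∘
          (Fin.consEquiv fun _ : Fin (k + 1) => ℕ) = fun x => f 0 x.1 * ∏ i, f i.succ (x.2 i) := by
        funext p
        simp [Fin.consEquiv, Fin.prod_univ_succ]
      rw [Fin.prod_univ_succ, e]
      exact this
    · convert h3 using 1
      funext p
      simp [Fin.consEquiv, Fin.prod_univ_succ]

/-- The generating function of `orderKCoeff`. -/
theorem hasSum_orderKCoeff (k : ℕ) (lam : ℝ) (z : ℂ) :
    HasSum (fun n : ℕ => (orderKCoeff k lam n : ℂ) * z ^ n)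
      (Complex.exp (lam * ∑ i : Fin k, z ^ ((i : ℕ) + 1))) := by
  have h1 : ∀ i : Fin k, HasSum (fun n : ℕ => ((lam : ℂ) * z ^ ((i : ℕ) + 1)) ^ n / n.factorial)
      (Complex.exp (lam * z ^ ((i : ℕ) + 1))) := fun i => by
    rw [Complex.exp_eq_exp_ℂ]; exact NormedSpace.expSeries_div_hasSum_exp _
  obtain ⟨h2, -⟩ := hasSum_prod_fin k _ _
    (fun i => NormedSpace.norm_expSeries_div_summable ((lam : ℂ) * z ^ ((i : ℕ) + 1))) h1
  have h3 := h2.tsum_fiberwise (fun v : Fin k → ℕ => ∑ i : Fin k, ((i : ℕ) + 1) * v i)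
  rw [Finset.mul_sum, Complex.exp_sum]
  suffices h : (fun n : ℕ => (orderKCoeff k lam n : ℂ) * z ^ n) = _ by
    rw [h]
    exact h3
  funext n
  rw [orderKCoeff, Complex.ofReal_tsum, ← tsum_mul_right,
    tsum_subtype ((fun v : Fin k → ℕ => ∑ i : Fin k, ((i : ℕ) + 1) * v i) ⁻¹' {n})
      (fun v : Fin k → ℕ => ∏ i : Fin k, ((lam : ℂ) * z ^ ((i : ℕ) + 1)) ^ v i / (v i).factorial)]
  refine tsum_congr fun v => ?_
  by_cases h : (∑ i : Fin k, ((i : ℕ) + 1) * v i) = n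
  · rw [if_pos h, Set.indicator_of_mem (by exact h), Finset.prod_div_distrib, ← h]
    simp only [mul_pow, Finset.prod_mul_distrib, Finset.prod_pow_eq_pow_sum, ← pow_mul]
    push_cast
    ring
  · rw [if_neg h, Set.indicator_of_notMem (by exact h)]
    simp

theorem orderKCoeff_nonneg (k : ℕ) {lam : ℝ} (hl : 0 ≤ lam) (n : ℕ) : 0 ≤ orderKCoeff k lam n :=
  tsum_nonneg fun v => by split_ifs <;> positivity

theorem hasSum_orderKCoeff_real (k : ℕ) (lam x : ℝ) :
    HasSum (fun n : ℕ => orderKCoeff k lam n * x ^ n)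
      (Real.exp (lam * ∑ i : Fin k, x ^ ((i : ℕ) + 1))) := by
  rw [← Complex.hasSum_ofReal]
  have := hasSum_orderKCoeff k lam x
  push_cast
  exact this

theorem finite_weight_eq (k n : ℕ) :
    {v : Fin k → ℕ | (∑ i : Fin k, ((i : ℕ) + 1) * v i) = n}.Finite := by
  refine (Set.Finite.pi' (t := fun _ : Fin k => Set.Iic n) fun _ => Set.finite_Iic n).subset ?_
  intro v hv i
  simp only [Set.mem_ofPred_eq] at hv
  have := Finset.single_le_sum (f := fun i : Fin k => ((i : ℕ) + 1) * v i) (fun _ _ => Nat.zero_le _)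
    (Finset.mem_univ i)
  simp only [Set.mem_Iic]
  nlinarith [Nat.zero_le (i * v i : ℕ)]

theorem orderKCoeff_zero (k : ℕ) (lam : ℝ) : orderKCoeff k lam 0 = 1 := by
  rw [orderKCoeff, tsum_eq_single 0]
  · simp
  · intro v hv
    rw [if_neg]
    intro h
    apply hv
    ext i
    have := Finset.sum_eq_zero_iff.1 h i (Finset.mem_univ i)
    simpa using this

theorem succ_mul_orderKCoeff (k : ℕ) (lam : ℝ) (n : ℕ) :
    n * orderKCoeff k lam n =
      lam * ∑ i : Fin k, if (i : ℕ) + 1 ≤ n then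
        ((i : ℕ) + 1) * orderKCoeff k lam (n - ((i : ℕ) + 1)) else 0 := by
  have hfin : ∀ (c : (Fin k → ℕ) → ℝ) (n : ℕ), Summable fun v : Fin k → ℕ =>
      if (∑ i : Fin k, ((i : ℕ) + 1) * v i) = n then c v else 0 := by
    intro c n
    refine summable_of_hasFiniteSupport ((finite_weight_eq k n).subset ?_)
    intro v hv
    by_contra h
    exact hv (if_neg h)
  have h1 : (n : ℝ) * orderKCoeff k lam n = ∑ i : Fin k, ((i : ℕ) + 1 : ℝ) *
      ∑' v : Fin k → ℕ, if (∑ i : Fin k, ((i : ℕ) + 1) * v i) = n then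
      v i * (lam ^ (∑ i : Fin k, v i) / ((∏ i : Fin k, Nat.factorial (v i) : ℕ) : ℝ)) else 0 := by
    rw [orderKCoeff, ← tsum_mul_left]
    simp_rw [← tsum_mul_left]
    rw [← Summable.tsum_finsetSum fun i _ => (hfin _ _).mul_left _]
    refine tsum_congr fun v => ?_
    by_cases h : (∑ i : Fin k, ((i : ℕ) + 1) * v i) = n
    · simp only [if_pos h, ← mul_assoc, ← Finset.sum_mul]
      rw [← h]
      push_cast
      rfl
    · simp [if_neg h]
  rw [h1, Finset.mul_sum]
  refine Finset.sum_congr rfl fun i _ => ?_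
  have hw : ∀ w : Fin k → ℕ, (∑ j : Fin k, ((j : ℕ) + 1) * (w + Pi.single i 1 : Fin k → ℕ) j) =
      (∑ j : Fin k, ((j : ℕ) + 1) * w j) + (i + 1) := by
    intro w
    simp only [Pi.add_apply, mul_add, Finset.sum_add_distrib]
    congr 1
    rw [Finset.sum_eq_single i (fun j _ hj => by simp [Pi.single_eq_of_ne hj]) (by simp)]
    simp
  have hinj : Function.Injective fun w : Fin k → ℕ => w + Pi.single i 1 :=
    add_left_injective _
  rw [← hinj.tsum_eq (f := fun v : Fin k → ℕ => if (∑ i : Fin k, ((i : ℕ) + 1) * v i) = n then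
      v i * (lam ^ (∑ i : Fin k, v i) / ((∏ i : Fin k, Nat.factorial (v i) : ℕ) : ℝ)) else 0)]
  · by_cases hi : (i : ℕ) + 1 ≤ n
    · rw [if_pos hi, mul_left_comm]
      congr 1
      rw [orderKCoeff, ← tsum_mul_left]
      refine tsum_congr fun w => ?_
      rw [hw]
      by_cases h : (∑ j : Fin k, ((j : ℕ) + 1) * w j) = n - (i + 1)
      · rw [if_pos h, if_pos (by omega)]
        have e1 : ∑ j : Fin k, (w + Pi.single i 1 : Fin k → ℕ) j = (∑ j : Fin k, w j) + 1 := by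
          simp [Finset.sum_add_distrib]
        have e2 : ∏ j : Fin k, ((w + Pi.single i 1 : Fin k → ℕ) j).factorial =
            (w i + 1) * ∏ j : Fin k, (w j).factorial := by
          rw [← Finset.mul_prod_erase _ _ (Finset.mem_univ i),
            ← Finset.mul_prod_erase Finset.univ (fun j => (w j).factorial) (Finset.mem_univ i),
            ← mul_assoc]
          congr 1
          · simp [Nat.factorial_succ]
          · refine Finset.prod_congr rfl fun j hj => ?_
            simp [Pi.single_eq_of_ne (Finset.ne_of_mem_erase hj)]
        rw [e1, e2]
        simp only [Pi.add_apply, Pi.single_eq_same]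
        have : ((∏ j : Fin k, (w j).factorial : ℕ) : ℝ) ≠ 0 := by
          exact_mod_cast (Finset.prod_pos fun j _ => Nat.factorial_pos _).ne'
        push_cast at this ⊢
        field_simp
        ring
      · rw [if_neg h, if_neg (by omega), mul_zero]
    · rw [if_neg hi, mul_zero]
      have : ∀ w : Fin k → ℕ, ¬ (∑ j : Fin k, ((j : ℕ) + 1) * (w + Pi.single i 1 : Fin k → ℕ) j) = n := by
        intro w; rw [hw]; omega
      simp [-Pi.add_apply, this]
  · intro v hv
    have hvi : v i ≠ 0 := by
      rintro h
      apply hv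
      simp [h]
    refine ⟨v - Pi.single i 1, ?_⟩
    ext j
    by_cases hj : j = i
    · subst hj; simp; omega
    · simp [Pi.single_eq_of_ne hj]

open Real in
theorem sin_mul_eq_dirichlet (M : ℕ) (t : ℝ) :
    sin ((M + 1 / 2) * t) = (1 / 2 + ∑ j ∈ Finset.range M, cos ((j + 1) * t)) * (2 * sin (t / 2)) := by
  induction M with
  | zero => simp; ring_nf
  | succ M ih =>
    rw [Finset.sum_range_succ, ← add_assoc, add_mul _ (cos _), ← ih]
    have h := sin_sub_sin (((M + 1 : ℕ) + 1 / 2) * t) ((M + 1 / 2) * t)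
    have e1 : ((((M + 1 : ℕ) : ℝ) + 1 / 2) * t - (M + 1 / 2) * t) / 2 = t / 2 := by
      push_cast; ring
    have e2 : ((((M + 1 : ℕ) : ℝ) + 1 / 2) * t + (M + 1 / 2) * t) / 2 = (M + 1) * t := by
      push_cast; ring
    rw [e1, e2] at h
    linarith

open Real in
theorem integral_dirichlet (M : ℕ) :
    ∫ t in (0 : ℝ)..π, (1 / 2 + ∑ j ∈ Finset.range M, cos ((j + 1) * t)) = π / 2 := by
  have hc : ∀ j : ℕ, Continuous fun t : ℝ => cos ((j + 1) * t) := fun j => by fun_prop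
  rw [intervalIntegral.integral_add (by simp) ((continuous_finsetSum _ fun j _ =>
    hc j).intervalIntegrable _ _), intervalIntegral.integral_finsetSum fun j _ =>
    (hc j).intervalIntegrable _ _]
  have : ∀ j : ℕ, ∫ t in (0 : ℝ)..π, cos ((j + 1) * t) = 0 := fun j => by
    rw [intervalIntegral.integral_comp_mul_left (fun t => cos t) (by positivity)]
    have := sin_nat_mul_pi (j + 1)
    push_cast at this
    simp [this]
  simp [this]
  ring

open Real in
/-- The sign `±1` and the order of the Dirichlet kernel `sin ((n - ν - 1/2) t) / (2 sin (t/2))`. -/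
theorem sin_shift_eq_dirichlet (n ν : ℕ) :
    ∃ M : ℕ, M ≤ n + ν ∧ ∀ t : ℝ, sin ((n - (ν + 1 / 2)) * t) =
      (if n ≤ ν then -1 else 1) *
        (1 / 2 + ∑ j ∈ Finset.range M, cos ((j + 1) * t)) * (2 * sin (t / 2)) := by
  by_cases h : n ≤ ν
  · obtain ⟨M, rfl⟩ := Nat.exists_eq_add_of_le h
    refine ⟨M, by omega, fun t => ?_⟩
    rw [if_pos h, mul_assoc, ← sin_mul_eq_dirichlet, neg_one_mul, ← sin_neg]
    push_cast
    ring_nf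
  · obtain ⟨M, rfl⟩ := Nat.exists_eq_add_of_lt (not_le.1 h)
    refine ⟨M, by omega, fun t => ?_⟩
    rw [if_neg h, mul_assoc, ← sin_mul_eq_dirichlet, one_mul]
    push_cast
    ring_nf

theorem poissonOrderKPmf_eq (k : ℕ) (lam : ℝ) (n : ℕ) :
    poissonOrderKPmf k lam n = Real.exp (-(k * lam)) * orderKCoeff k lam n := rfl

theorem hasSum_poissonOrderKPmf (k : ℕ) (lam : ℝ) : HasSum (poissonOrderKPmf k lam) 1 := by
  have h := (hasSum_orderKCoeff_real k lam 1).mul_left (Real.exp (-(k * lam)))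
  simp only [one_pow, mul_one, ← Real.exp_add, ← poissonOrderKPmf_eq] at h
  simpa [mul_comm] using h

/-- The integrand in the inversion formula for the distribution function. -/
noncomputable def inversionIntegrand (k : ℕ) (lam x t : ℝ) : ℝ :=
  Real.exp (-(lam * ∑ j ∈ Finset.range k, (1 - Real.cos ((j + 1) * t)))) *
    (Real.sin (lam * (∑ j ∈ Finset.range k, Real.sin ((j + 1) * t)) - x * t) /
      (2 * Real.sin (t / 2)))

theorem hasSum_inversionIntegrand (k : ℕ) (lam x t : ℝ) :
    HasSum (fun n : ℕ => poissonOrderKPmf k lam n * (Real.sin ((n - x) * t) /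
      (2 * Real.sin (t / 2)))) (inversionIntegrand k lam x t) := by
  have h := (hasSum_orderKCoeff k lam (Complex.exp (t * Complex.I))).mul_left
    (Complex.exp (-(k * lam) - x * t * Complex.I))
  have h2 := (Complex.hasSum_im h).mul_right (2 * Real.sin (t / 2))⁻¹
  suffices e : inversionIntegrand k lam x t = _ ∧ (fun n : ℕ => poissonOrderKPmf k lam n *
      (Real.sin ((n - x) * t) / (2 * Real.sin (t / 2)))) = _ by
    rw [e.1, e.2]
    exact h2
  have hexp : ∀ a b : ℝ, (Complex.exp (a + b * Complex.I)).im = Real.exp a * Real.sin b := by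
    simp [Complex.exp_im]
  constructor
  · rw [inversionIntegrand, ← Complex.exp_add, ← mul_div_assoc, div_eq_mul_inv]
    congr 1
    have e : -((k : ℂ) * lam) - x * t * Complex.I +
        lam * ∑ i : Fin k, Complex.exp (t * Complex.I) ^ ((i : ℕ) + 1) =
        ((-(lam * ∑ j ∈ Finset.range k, (1 - Real.cos ((j + 1) * t))) : ℝ) : ℂ) +
        ((lam * (∑ j ∈ Finset.range k, Real.sin ((j + 1) * t)) - x * t : ℝ) : ℂ) * Complex.I := by
      have e1 : ∀ i : ℕ, Complex.exp (t * Complex.I) ^ (i + 1) =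
          Complex.cos ((i + 1) * t) + Complex.sin ((i + 1) * t) * Complex.I := fun i => by
        rw [← Complex.exp_nat_mul, ← Complex.exp_mul_I]
        push_cast
        ring_nf
      rw [Finset.sum_congr rfl fun (i : Fin k) _ => e1 i, Finset.sum_add_distrib, ← Finset.sum_mul,
        ← Finset.sum_range fun i : ℕ => Complex.cos ((i + 1) * t),
        ← Finset.sum_range fun i : ℕ => Complex.sin ((i + 1) * t)]
      rw [Finset.sum_sub_distrib]
      push_cast
      simp
      ring
    rw [e, hexp]
  · funext n
    rw [poissonOrderKPmf_eq, div_eq_mul_inv, ← mul_assoc]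
    congr 1
    have e : Complex.exp (-(k * lam) - x * t * Complex.I) *
        (orderKCoeff k lam n * Complex.exp (t * Complex.I) ^ n) = (orderKCoeff k lam n : ℝ) *
        Complex.exp (((-(k * lam) : ℝ) : ℂ) + ((n - x) * t : ℝ) * Complex.I) := by
      rw [← Complex.exp_nat_mul, mul_left_comm, ← Complex.exp_add]
      push_cast
      ring_nf
    rw [e, Complex.im_ofReal_mul, hexp]
    ring

open Real in
theorem integral_inversionIntegrand (k : ℕ) {lam : ℝ} (hl : 0 ≤ lam) (ν : ℕ) :
    ∫ t in (0 : ℝ)..π, inversionIntegrand k lam (ν + 1 / 2) t =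
      π / 2 * (1 - 2 * ∑ j ∈ Finset.range (ν + 1), poissonOrderKPmf k lam j) := by
  have hp : ∀ n, 0 ≤ poissonOrderKPmf k lam n := fun n => by
    rw [poissonOrderKPmf_eq]
    exact mul_nonneg (exp_pos _).le (orderKCoeff_nonneg k hl n)
  choose M hM hMt using fun n => sin_shift_eq_dirichlet n ν
  have hpos : ∀ t ∈ Set.uIoc 0 π, 0 < 2 * sin (t / 2) := fun t ht => by
    rw [Set.uIoc_of_le pi_pos.le] at ht
    have := sin_pos_of_pos_of_lt_pi (x := t / 2) (by linarith [ht.1]) (by linarith [ht.2, pi_pos])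
    linarith
  have hdir : ∀ n : ℕ, ∀ t ∈ Set.uIoc 0 π, sin ((n - (ν + 1 / 2)) * t) / (2 * sin (t / 2)) =
      (if n ≤ ν then -1 else 1) * (1 / 2 + ∑ j ∈ Finset.range (M n), cos ((j + 1) * t)) := by
    intro n t ht
    rw [hMt, mul_div_assoc, div_self (hpos t ht).ne', mul_one]
  have hsum : Summable fun n : ℕ => poissonOrderKPmf k lam n * (n + ν + 1) := by
    have h := (hasSum_orderKCoeff_real k lam 2).summable.mul_left (exp (-(k * lam)) * (ν + 2))
    refine h.of_nonneg_of_le (fun n => mul_nonneg (hp n) (by positivity)) fun n => ?_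
    rw [poissonOrderKPmf_eq]
    have h1 : ((n : ℝ) + 1) ≤ 2 ^ n := by exact_mod_cast Nat.lt_two_pow_self
    have h2 : (n + ν + 1 : ℝ) ≤ (ν + 2) * 2 ^ n := by
      nlinarith [(Nat.cast_nonneg ν : (0 : ℝ) ≤ ν), (Nat.cast_nonneg n : (0 : ℝ) ≤ n)]
    calc _ ≤ (exp (-(k * lam)) * orderKCoeff k lam n) * ((ν + 2) * 2 ^ n) :=
          mul_le_mul_of_nonneg_left h2 (hp n)
      _ = _ := by ring
  have h1 := intervalIntegral.hasSum_integral_of_dominated_convergence (a := 0) (b := π)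
    (μ := MeasureTheory.volume)
    (F := fun (n : ℕ) t => poissonOrderKPmf k lam n * (sin ((n - (ν + 1 / 2)) * t) /
      (2 * sin (t / 2)))) (f := inversionIntegrand k lam (ν + 1 / 2))
    (fun n _ => poissonOrderKPmf k lam n * (n + ν + 1))
    (fun n => by
      refine Measurable.aestronglyMeasurable ?_
      fun_prop)
    (fun n => Filter.Eventually.of_forall fun t ht => by
      rw [hdir n t ht, norm_mul, norm_of_nonneg (hp n)]
      refine mul_le_mul_of_nonneg_left ?_ (hp n)
      have e1 : ‖(if n ≤ ν then -1 else 1 : ℝ)‖ = 1 := by split_ifs <;> simp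
      rw [norm_mul, e1, one_mul]
      refine (norm_add_le _ _).trans ?_
      have e2 : ‖∑ j ∈ Finset.range (M n), cos ((j + 1) * t)‖ ≤ M n := by
        refine (norm_sum_le _ _).trans ?_
        refine (Finset.sum_le_sum fun (j : ℕ) _ => abs_cos_le_one (((j : ℝ) + 1) * t)).trans ?_
        simp
      have e3 : (M n : ℝ) ≤ n + ν := by exact_mod_cast hM n
      norm_num
      norm_num at e2
      linarith)
    (Filter.Eventually.of_forall fun t _ => hsum) (by simp)
    (Filter.Eventually.of_forall fun t _ => hasSum_inversionIntegrand k lam _ t)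
  have h2 : ∀ n : ℕ, ∫ t in (0 : ℝ)..π, poissonOrderKPmf k lam n *
      (sin ((n - (ν + 1 / 2)) * t) / (2 * sin (t / 2))) =
      π / 2 * (poissonOrderKPmf k lam n - 2 * (if n ∈ Finset.range (ν + 1) then
        poissonOrderKPmf k lam n else 0)) := by
    intro n
    rw [intervalIntegral.integral_const_mul,
      intervalIntegral.integral_congr_ae (g := fun t => (if n ≤ ν then -1 else 1) *
        (1 / 2 + ∑ j ∈ Finset.range (M n), cos ((j + 1) * t)))
        (Filter.Eventually.of_forall (hdir n)), intervalIntegral.integral_const_mul,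
      integral_dirichlet]
    by_cases h : n ≤ ν
    · rw [if_pos h, if_pos (by simpa [Nat.lt_succ_iff] using h)]
      ring
    · rw [if_neg h, if_neg (by simpa [Nat.lt_succ_iff] using h)]
      ring
  simp_rw [h2] at h1
  refine h1.unique ?_
  refine HasSum.mul_left _ ((hasSum_poissonOrderKPmf k lam).sub (HasSum.mul_left _ ?_))
  rw [← Finset.sum_congr rfl fun j hj => if_pos hj]
  exact hasSum_sum_of_ne_finset_zero fun n hn => if_neg hn

theorem continuous_cdf (k ν : ℕ) :
    Continuous fun lam : ℝ => ∑ j ∈ Finset.range (ν + 1), poissonOrderKPmf k lam j := by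
  refine continuous_finsetSum _ fun n _ => ?_
  simp_rw [poissonOrderKPmf_eq]
  refine Continuous.mul (by fun_prop) ?_
  have : ∀ lam : ℝ, orderKCoeff k lam n = ∑ v ∈ (finite_weight_eq k n).toFinset,
      lam ^ (∑ i : Fin k, v i) / ((∏ i : Fin k, Nat.factorial (v i) : ℕ) : ℝ) := by
    intro lam
    rw [orderKCoeff, tsum_eq_sum (s := (finite_weight_eq k n).toFinset)]
    · refine Finset.sum_congr rfl fun v hv => if_pos ?_
      simpa using hv
    · intro v hv
      exact if_neg (by simpa using hv)
  simp_rw [this]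
  fun_prop

section PowerSums

theorem sum_succ_pow_one (k : ℕ) :
    ∑ j ∈ Finset.range k, ((j : ℝ) + 1) = (k : ℝ) * (k + 1) / 2 := by
  induction k with
  | zero => simp
  | succ k ih => rw [Finset.sum_range_succ, ih]; push_cast; ring

theorem sum_succ_pow_two (k : ℕ) :
    ∑ j ∈ Finset.range k, ((j : ℝ) + 1) ^ 2 = (k : ℝ) * (k + 1) * (2 * k + 1) / 6 := by
  induction k with
  | zero => simp
  | succ k ih => rw [Finset.sum_range_succ, ih]; push_cast; ring

theorem sum_succ_pow_three (k : ℕ) :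
    ∑ j ∈ Finset.range k, ((j : ℝ) + 1) ^ 3 = ((k : ℝ) * (k + 1) / 2) ^ 2 := by
  induction k with
  | zero => simp
  | succ k ih => rw [Finset.sum_range_succ, ih]; push_cast; ring

theorem sum_succ_pow_four (k : ℕ) :
    ∑ j ∈ Finset.range k, ((j : ℝ) + 1) ^ 4 =
      (k : ℝ) * (k + 1) * (2 * k + 1) / 6 * ((3 * (2 * k + 1) ^ 2 - 7) / 20) := by
  induction k with
  | zero => simp
  | succ k ih => rw [Finset.sum_range_succ, ih]; push_cast; ring

theorem sum_succ_pow_five (k : ℕ) :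
    ∑ j ∈ Finset.range k, ((j : ℝ) + 1) ^ 5 =
      ((k : ℝ) * (k + 1) / 2) ^ 2 * (((2 * k + 1) ^ 2 - 3) / 6) := by
  induction k with
  | zero => simp
  | succ k ih => rw [Finset.sum_range_succ, ih]; push_cast; ring

theorem sum_succ_pow_six (k : ℕ) :
    ∑ j ∈ Finset.range k, ((j : ℝ) + 1) ^ 6 =
      (k : ℝ) * (k + 1) * (2 * k + 1) / 6 * ((3 * (k * (k + 1)) ^ 2 - 3 * (k * (k + 1)) + 1) / 7) := by
  induction k with
  | zero => simp
  | succ k ih => rw [Finset.sum_range_succ, ih]; push_cast; ring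

theorem sum_succ_pow_seven (k : ℕ) :
    ∑ j ∈ Finset.range k, ((j : ℝ) + 1) ^ 7 =
      ((k : ℝ) * (k + 1) / 2) ^ 2 * ((3 * (k * (k + 1)) ^ 2 - 4 * (k * (k + 1)) + 2) / 6) := by
  induction k with
  | zero => simp
  | succ k ih => rw [Finset.sum_range_succ, ih]; push_cast; ring

end PowerSums

section Taylor

theorem nonneg_of_hasDerivAt_nonneg {f f' : ℝ → ℝ} (h0 : f 0 = 0)
    (hd : ∀ x, HasDerivAt f (f' x) x) (hf' : ∀ x, 0 ≤ x → 0 ≤ f' x) {x : ℝ} (hx : 0 ≤ x) :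
    0 ≤ f x := by
  have hm : MonotoneOn f (Set.Ici 0) := by
    refine monotoneOn_of_deriv_nonneg (convex_Ici 0)
      (fun y _ => (hd y).continuousAt.continuousWithinAt)
      (fun y _ => (hd y).differentiableAt.differentiableWithinAt) fun y hy => ?_
    rw [interior_Ici] at hy
    rw [(hd y).deriv]
    exact hf' y (le_of_lt hy)
  have := hm (Set.mem_Ici.2 le_rfl) (Set.mem_Ici.2 hx) hx
  rwa [h0] at this

open Real

theorem cos_le_quartic {x : ℝ} (hx : 0 ≤ x) : cos x ≤ 1 - x ^ 2 / 2 + x ^ 4 / 24 := by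
  have := nonneg_of_hasDerivAt_nonneg (f := fun x => 1 - x ^ 2 / 2 + x ^ 4 / 24 - cos x)
    (f' := fun x => -x + x ^ 3 / 6 + sin x) (by simp)
    (fun x => by
      refine (((((hasDerivAt_id x).pow 2).div_const 2).const_sub 1).add
        (((hasDerivAt_id x).pow 4).div_const 24) |>.sub (hasDerivAt_cos x)).congr_deriv ?_
      simp; ring)
    (fun x hx => by have := sin_ge_sub_cube hx; linarith) hx
  linarith

theorem sin_le_quintic {x : ℝ} (hx : 0 ≤ x) : sin x ≤ x - x ^ 3 / 6 + x ^ 5 / 120 := by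
  have := nonneg_of_hasDerivAt_nonneg (f := fun x => x - x ^ 3 / 6 + x ^ 5 / 120 - sin x)
    (f' := fun x => 1 - x ^ 2 / 2 + x ^ 4 / 24 - cos x) (by simp)
    (fun x => by
      refine (((hasDerivAt_id x).sub (((hasDerivAt_id x).pow 3).div_const 6)).add
        (((hasDerivAt_id x).pow 5).div_const 120) |>.sub (hasDerivAt_sin x)).congr_deriv ?_
      simp; ring)
    (fun x hx => by have := cos_le_quartic hx; linarith) hx
  linarith

theorem sextic_le_cos {x : ℝ} (hx : 0 ≤ x) :
    1 - x ^ 2 / 2 + x ^ 4 / 24 - x ^ 6 / 720 ≤ cos x := by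
  have := nonneg_of_hasDerivAt_nonneg
    (f := fun x => cos x - (1 - x ^ 2 / 2 + x ^ 4 / 24 - x ^ 6 / 720))
    (f' := fun x => x - x ^ 3 / 6 + x ^ 5 / 120 - sin x) (by simp)
    (fun x => by
      refine ((hasDerivAt_cos x).sub (((((hasDerivAt_id x).pow 2).div_const 2).const_sub 1).add
        (((hasDerivAt_id x).pow 4).div_const 24) |>.sub
        (((hasDerivAt_id x).pow 6).div_const 720))).congr_deriv ?_
      simp; ring)
    (fun x hx => by have := sin_le_quintic hx; linarith) hx
  linarith

theorem septic_le_sin {x : ℝ} (hx : 0 ≤ x) :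
    x - x ^ 3 / 6 + x ^ 5 / 120 - x ^ 7 / 5040 ≤ sin x := by
  have := nonneg_of_hasDerivAt_nonneg
    (f := fun x => sin x - (x - x ^ 3 / 6 + x ^ 5 / 120 - x ^ 7 / 5040))
    (f' := fun x => cos x - (1 - x ^ 2 / 2 + x ^ 4 / 24 - x ^ 6 / 720)) (by simp)
    (fun x => by
      refine ((hasDerivAt_sin x).sub (((hasDerivAt_id x).sub
        (((hasDerivAt_id x).pow 3).div_const 6)).add
        (((hasDerivAt_id x).pow 5).div_const 120) |>.sub
        (((hasDerivAt_id x).pow 7).div_const 5040))).congr_deriv ?_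
      simp; ring)
    (fun x hx => by have := sextic_le_cos hx; linarith) hx
  linarith

end Taylor

section PhaseBounds

variable (k : ℕ) (lam t : ℝ)

/-- The ratio `m² / (λ Σ j²)` with `m = 2k + 1`. -/
noncomputable def ratioU : ℝ := 24 * (2 * k + 1) / (((2 * k + 1) ^ 2 - 1) * lam)

/-- The variance times `t²`. -/
noncomputable def scaledSq : ℝ := lam * (((2 * k + 1) ^ 2 - 1) * (2 * k + 1) / 24) * t ^ 2

/-- The leading coefficient `Σ j³ / (6 Σ j²)`. -/
noncomputable def skewC : ℝ := ((2 * k + 1) ^ 2 - 1) / (16 * (2 * k + 1))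

/-- `λ` times the sum of `j t - sin (j t)`. -/
noncomputable def phaseDefect : ℝ :=
  lam * ∑ j ∈ Finset.range k, (((j : ℝ) + 1) * t - Real.sin ((j + 1) * t))

/-- `λ t` times the derivative of the sum of `1 - cos (j t)`. -/
noncomputable def dampingDeriv : ℝ :=
  lam * ∑ j ∈ Finset.range k, (((j : ℝ) + 1) * t * Real.sin ((j + 1) * t))

/-- `λ` times the sum of `1 - cos (j t)`. -/
noncomputable def damping : ℝ :=
  lam * ∑ j ∈ Finset.range k, (1 - Real.cos ((j + 1) * t))

variable {k lam t}

theorem sq_sub_one_pos (hk : 2 ≤ k) : (24 : ℝ) ≤ (2 * k + 1) ^ 2 - 1 := by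
  have : (2 : ℝ) ≤ k := by exact_mod_cast hk
  nlinarith

theorem skewC_mul_scaledSq (hk : 2 ≤ k) :
    skewC k * t * scaledSq k lam t = lam * ((k * (k + 1) / 2) ^ 2 * t ^ 3 / 6) := by
  rw [skewC, scaledSq]
  field_simp
  ring

theorem ratioU_mul_scaledSq (hk : 2 ≤ k) (hl : 0 < lam) :
    ratioU k lam * scaledSq k lam t = (2 * k + 1) ^ 2 * t ^ 2 := by
  rw [ratioU, scaledSq]
  have := sq_sub_one_pos hk
  field_simp

theorem phaseDefect_le (hk : 2 ≤ k) (hl : 0 < lam) (ht : 0 ≤ t) :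
    phaseDefect k lam t ≤ skewC k * t * scaledSq k lam t := by
  rw [skewC_mul_scaledSq hk, phaseDefect]
  refine mul_le_mul_of_nonneg_left ?_ hl.le
  rw [← sum_succ_pow_three, Finset.sum_mul, Finset.sum_div]
  refine Finset.sum_le_sum fun j _ => ?_
  have := Real.sin_ge_sub_cube (x := (j + 1) * t) (by positivity)
  linarith [mul_pow ((j : ℝ) + 1) t 3]

theorem le_phaseDefect (hk : 2 ≤ k) (hl : 0 < lam) (ht : 0 ≤ t) :
    skewC k * t * (scaledSq k lam t -
      (1 - 3 / (2 * k + 1) ^ 2) / 120 * ratioU k lam * scaledSq k lam t ^ 2) ≤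
      phaseDefect k lam t := by
  have e : skewC k * t * (scaledSq k lam t -
      (1 - 3 / (2 * k + 1) ^ 2) / 120 * ratioU k lam * scaledSq k lam t ^ 2) =
      lam * (∑ j ∈ Finset.range k, (((j + 1) * t) ^ 3 / 6 - ((j + 1) * t) ^ 5 / 120)) := by
    simp_rw [mul_pow]
    rw [Finset.sum_sub_distrib, ← Finset.sum_div, ← Finset.sum_div, ← Finset.sum_mul,
      ← Finset.sum_mul, sum_succ_pow_three, sum_succ_pow_five]
    have h1 := ratioU_mul_scaledSq (t := t) hk hl
    have h2 := skewC_mul_scaledSq (t := t) (lam := lam) hk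
    calc _ = (skewC k * t * scaledSq k lam t) * (1 - (1 - 3 / (2 * k + 1) ^ 2) / 120 *
          (ratioU k lam * scaledSq k lam t)) := by ring
      _ = _ := by rw [h1, h2]; field_simp
  rw [e, phaseDefect]
  refine mul_le_mul_of_nonneg_left (Finset.sum_le_sum fun j _ => ?_) hl.le
  have := sin_le_quintic (x := (j + 1) * t) (by positivity)
  linarith

theorem phaseDefect_le' (hk : 2 ≤ k) (hl : 0 < lam) (ht : 0 ≤ t) :
    phaseDefect k lam t ≤ skewC k * t * (scaledSq k lam t -
      (1 - 3 / (2 * k + 1) ^ 2) / 120 * ratioU k lam * scaledSq k lam t ^ 2 +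
      ratioU k lam ^ 2 * scaledSq k lam t ^ 3 / 26880) := by
  have e : lam * (∑ j ∈ Finset.range k, (((j + 1) * t) ^ 3 / 6 - ((j + 1) * t) ^ 5 / 120 +
      ((j + 1) * t) ^ 7 / 5040)) ≤ skewC k * t * (scaledSq k lam t -
      (1 - 3 / (2 * k + 1) ^ 2) / 120 * ratioU k lam * scaledSq k lam t ^ 2 +
      ratioU k lam ^ 2 * scaledSq k lam t ^ 3 / 26880) := by
    simp_rw [mul_pow]
    rw [Finset.sum_add_distrib, Finset.sum_sub_distrib, ← Finset.sum_div, ← Finset.sum_div,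
      ← Finset.sum_div, ← Finset.sum_mul, ← Finset.sum_mul, ← Finset.sum_mul,
      sum_succ_pow_three, sum_succ_pow_five, sum_succ_pow_seven]
    have h1 := ratioU_mul_scaledSq (t := t) hk hl
    have h2 := skewC_mul_scaledSq (t := t) (lam := lam) hk
    have h3 : skewC k * t * (scaledSq k lam t -
      (1 - 3 / (2 * k + 1) ^ 2) / 120 * ratioU k lam * scaledSq k lam t ^ 2 +
      ratioU k lam ^ 2 * scaledSq k lam t ^ 3 / 26880) =
      lam * ((k * (k + 1) / 2) ^ 2 * t ^ 3 / 6) * (1 - (1 - 3 / (2 * k + 1) ^ 2) / 120 *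
          ((2 * k + 1) ^ 2 * t ^ 2) + ((2 * k + 1) ^ 2 * t ^ 2) ^ 2 / 26880) := by
      rw [← h1, ← h2]; ring
    rw [h3, mul_assoc lam]
    refine mul_le_mul_of_nonneg_left ?_ hl.le
    have h4 : (1 - 3 / (2 * (k : ℝ) + 1) ^ 2) / 120 * ((2 * k + 1) ^ 2 * t ^ 2) =
        ((2 * k + 1) ^ 2 - 3) * t ^ 2 / 120 := by field_simp
    rw [h4]
    have hk' : (2 : ℝ) ≤ k := by exact_mod_cast hk
    have h5 : 0 ≤ (k * (k + 1) / 2 : ℝ) ^ 2 * t ^ 7 * (88 * k * (k + 1) - 29) := by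
      have : 0 ≤ 88 * (k : ℝ) * (k + 1) - 29 := by nlinarith
      positivity
    linarith [h5]
  refine le_trans ?_ e
  rw [phaseDefect]
  refine mul_le_mul_of_nonneg_left (Finset.sum_le_sum fun j _ => ?_) hl.le
  have := septic_le_sin (x := (j + 1) * t) (by positivity)
  linarith

theorem phaseDefect_nonneg (hl : 0 < lam) (ht : 0 ≤ t) : 0 ≤ phaseDefect k lam t := by
  refine mul_nonneg hl.le (Finset.sum_nonneg fun j _ => sub_nonneg.2 ?_)
  exact Real.sin_le (by positivity)

theorem scaledSq_eq : scaledSq k lam t = lam * ((k * (k + 1) * (2 * k + 1) / 6) * t ^ 2) := by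
  rw [scaledSq]; ring

theorem dampingDeriv_le (hl : 0 < lam) (ht : 0 ≤ t) :
    dampingDeriv k lam t ≤ scaledSq k lam t := by
  rw [scaledSq_eq, dampingDeriv, ← sum_succ_pow_two, Finset.sum_mul]
  refine mul_le_mul_of_nonneg_left (Finset.sum_le_sum fun j _ => ?_) hl.le
  have := Real.sin_le (x := (j + 1) * t) (by positivity)
  nlinarith [mul_le_mul_of_nonneg_left this (by positivity : 0 ≤ ((j : ℝ) + 1) * t)]

theorem le_dampingDeriv (hk : 2 ≤ k) (hl : 0 < lam) (ht : 0 ≤ t) :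
    scaledSq k lam t - (3 - 7 / (2 * k + 1) ^ 2) / 120 * ratioU k lam * scaledSq k lam t ^ 2 ≤
      dampingDeriv k lam t := by
  have h1 := ratioU_mul_scaledSq (t := t) hk hl
  have e : scaledSq k lam t -
      (3 - 7 / (2 * k + 1) ^ 2) / 120 * ratioU k lam * scaledSq k lam t ^ 2 =
      lam * (∑ j ∈ Finset.range k, (((j + 1) ^ 2 * t ^ 2 - ((j + 1) ^ 4 * t ^ 4) / 6))) := by
    rw [Finset.sum_sub_distrib, ← Finset.sum_div, ← Finset.sum_mul,
      ← Finset.sum_mul, sum_succ_pow_two, sum_succ_pow_four]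
    calc _ = scaledSq k lam t * (1 - (3 - 7 / (2 * k + 1) ^ 2) / 120 *
          (ratioU k lam * scaledSq k lam t)) := by ring
      _ = _ := by rw [h1, scaledSq_eq]; field_simp; ring
  rw [e, dampingDeriv]
  refine mul_le_mul_of_nonneg_left (Finset.sum_le_sum fun j _ => ?_) hl.le
  have := Real.sin_ge_sub_cube (x := (j + 1) * t) (by positivity)
  nlinarith [mul_le_mul_of_nonneg_left this (by positivity : 0 ≤ ((j : ℝ) + 1) * t)]

theorem dampingDeriv_le' (hk : 2 ≤ k) (hl : 0 < lam) (ht : 0 ≤ t) :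
    dampingDeriv k lam t ≤ scaledSq k lam t -
      (3 - 7 / (2 * k + 1) ^ 2) / 120 * ratioU k lam * scaledSq k lam t ^ 2 +
      ratioU k lam ^ 2 * scaledSq k lam t ^ 3 / 4480 := by
  have h1 := ratioU_mul_scaledSq (t := t) hk hl
  have e : lam * (∑ j ∈ Finset.range k, ((j + 1) ^ 2 * t ^ 2 - ((j + 1) ^ 4 * t ^ 4) / 6 +
      ((j + 1) ^ 6 * t ^ 6) / 120)) ≤ scaledSq k lam t -
      (3 - 7 / (2 * k + 1) ^ 2) / 120 * ratioU k lam * scaledSq k lam t ^ 2 +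
      ratioU k lam ^ 2 * scaledSq k lam t ^ 3 / 4480 := by
    rw [Finset.sum_add_distrib, Finset.sum_sub_distrib, ← Finset.sum_div, ← Finset.sum_div,
      ← Finset.sum_mul, ← Finset.sum_mul, ← Finset.sum_mul,
      sum_succ_pow_two, sum_succ_pow_four, sum_succ_pow_six]
    have h3 : scaledSq k lam t -
      (3 - 7 / (2 * k + 1) ^ 2) / 120 * ratioU k lam * scaledSq k lam t ^ 2 +
      ratioU k lam ^ 2 * scaledSq k lam t ^ 3 / 4480 =
      lam * ((k * (k + 1) * (2 * k + 1) / 6) * t ^ 2) * (1 - (3 - 7 / (2 * k + 1) ^ 2) / 120 *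
          ((2 * k + 1) ^ 2 * t ^ 2) + ((2 * k + 1) ^ 2 * t ^ 2) ^ 2 / 4480) := by
      rw [← h1, ← scaledSq_eq]; ring
    rw [h3, mul_assoc lam]
    refine mul_le_mul_of_nonneg_left ?_ hl.le
    have h4 : (3 - 7 / (2 * (k : ℝ) + 1) ^ 2) / 120 * ((2 * k + 1) ^ 2 * t ^ 2) =
        (3 * (2 * k + 1) ^ 2 - 7) * t ^ 2 / 120 := by field_simp
    rw [h4]
    have hk' : (2 : ℝ) ≤ k := by exact_mod_cast hk
    have h5 : 0 ≤ (k * (k + 1) * (2 * k + 1) / 6) * t ^ 6 * (72 * (k : ℝ) * (k + 1) - 13) := by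
      have : 0 ≤ 72 * (k : ℝ) * (k + 1) - 13 := by nlinarith
      positivity
    linarith [h5]
  refine le_trans ?_ e
  rw [dampingDeriv]
  refine mul_le_mul_of_nonneg_left (Finset.sum_le_sum fun j _ => ?_) hl.le
  have := sin_le_quintic (x := (j + 1) * t) (by positivity)
  nlinarith [mul_le_mul_of_nonneg_left this (by positivity : 0 ≤ ((j : ℝ) + 1) * t)]

theorem damping_le (hl : 0 < lam) : damping k lam t ≤ scaledSq k lam t / 2 := by
  rw [scaledSq_eq, damping, ← sum_succ_pow_two, Finset.sum_mul, mul_div_assoc, Finset.sum_div]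
  refine mul_le_mul_of_nonneg_left (Finset.sum_le_sum fun j _ => ?_) hl.le
  have := Real.one_sub_sq_div_two_le_cos (x := (j + 1) * t)
  linarith [mul_pow ((j : ℝ) + 1) t 2]

theorem hasDerivAt_damping (k : ℕ) (lam t : ℝ) : HasDerivAt (damping k lam)
    (lam * ∑ j ∈ Finset.range k, (((j : ℝ) + 1) * Real.sin ((j + 1) * t))) t := by
  refine HasDerivAt.const_mul _ (HasDerivAt.fun_sum fun j _ => ?_)
  have h := ((hasDerivAt_id t).const_mul ((j : ℝ) + 1)).cos.const_sub 1
  refine h.congr_deriv ?_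
  simp
  ring

end PhaseBounds

section Pointwise

open Real

theorem le_neg_sin (x : ℝ) : -x + x ^ 3 / 6 - (max x 0) ^ 5 / 120 ≤ -sin x := by
  rcases le_total 0 x with h | h
  · rw [max_eq_left h]
    linarith [sin_le_quintic h]
  · rw [max_eq_right h]
    have := sin_ge_sub_cube (x := -x) (by linarith)
    rw [sin_neg] at this
    nlinarith

theorem neg_sin_le (x : ℝ) : -sin x ≤ -x + x ^ 3 / 6 + (max (-x) 0) ^ 5 / 120 := by
  rcases le_total x 0 with h | h
  · rw [max_eq_left (by linarith)]
    have := sin_le_quintic (x := -x) (by linarith)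
    rw [sin_neg] at this
    nlinarith
  · rw [max_eq_right (by linarith)]
    have := sin_ge_sub_cube h
    nlinarith

theorem two_mul_sin_half_bounds {t : ℝ} (h0 : 0 < t) (h1 : t ≤ 4 / 5) :
    0 < 2 * sin (t / 2) ∧ 2 * sin (t / 2) ≤ t ∧ t ≤ 2 * sin (t / 2) * (1 + t ^ 2 / 23) := by
  have e1 := sin_ge_sub_cube (x := t / 2) (by linarith)
  have e2 := sin_le (x := t / 2) (by linarith)
  have e3 : t ^ 2 ≤ 16 / 25 := by nlinarith
  refine ⟨?_, by linarith, ?_⟩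
  · have : 0 < t * (1 - t ^ 2 / 24) := mul_pos h0 (by linarith)
    nlinarith
  · have e4 : t * (1 - t ^ 2 / 24) ≤ 2 * sin (t / 2) := by linarith
    have e5 : t ≤ t * (1 - t ^ 2 / 24) * (1 + t ^ 2 / 23) := by
      have : 1 ≤ (1 - t ^ 2 / 24) * (1 + t ^ 2 / 23) := by nlinarith [sq_nonneg t]
      nlinarith
    exact e5.trans (mul_le_mul_of_nonneg_right e4 (by positivity))

/-- The polynomial minorant of the inversion integrand. -/
noncomputable def minorant (u v h s : ℝ) : ℝ :=
  1 + h * u - s + (1 - 3 * v) / 120 * u * s ^ 2 - u ^ 2 * s ^ 3 / 26880 +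
    (1 - v) ^ 2 / 1536 * u * (s ^ 4 - 3 * s ^ 3 + 3 * s ^ 2 - s) -
    u ^ 2 / 512 * (h + s ^ 2 / 120) * (s ^ 3 - 2 * s ^ 2 + s) -
    u ^ 2 / 590 * (h ^ 2 * s + s ^ 5 / 14400) -
    u ^ 2 * (s ^ 7 - 5 * s ^ 6 + 10 * s ^ 5) / 7864320 - u * v * s ^ 2 / 23

theorem minorant_le {c t s u v h E : ℝ} (hc : 0 < c) (ht : 0 < t) (ht1 : t ≤ 4 / 5) (hs : 0 ≤ s)
    (hu : 0 < u) (hu1 : u ≤ 3 / 7) (hv : 0 ≤ v) (hv1 : v ≤ 1 / 25) (hh : 0 ≤ h) (hh1 : h ≤ 0.043)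
    (hct : c ^ 2 * t ^ 2 = (1 - v) ^ 2 * u * s / 256) (hus : u * s ≤ 16) (htt : t ^ 2 = s * u * v)
    (hE0 : 0 ≤ E) (hE1 : E ≤ s) (hE2 : s - (1 - 3 * v) / 120 * u * s ^ 2 ≤ E)
    (hE3 : E ≤ s - (1 - 3 * v) / 120 * u * s ^ 2 + u ^ 2 * s ^ 3 / 26880) :
    c * minorant u v h s ≤ sin (c * t * (1 + h * u - E)) / (2 * sin (t / 2)) := by
  obtain ⟨hy0, hy1, hy2⟩ := two_mul_sin_half_bounds ht ht1
  generalize 2 * sin (t / 2) = y at *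
  obtain ⟨X, hX⟩ : ∃ X, X = E - 1 - h * u := ⟨_, rfl⟩
  have hθ : c * t * (1 + h * u - E) = -(c * t * X) := by rw [hX]; ring
  rw [hθ, sin_neg]
  have hct0 : 0 < c * t := mul_pos hc ht
  have hhu : h * u ≤ 0.0185 := (mul_le_mul hh1 hu1 hu.le (by norm_num)).trans (by norm_num)
  have hhu0 : 0 ≤ h * u := by positivity
  -- the kernel factor
  have hker : -sin (c * t * X) / t - c * (u * v * s ^ 2 / 23) ≤ -sin (c * t * X) / y := by
    rcases le_total (sin (c * t * X)) 0 with hS | hS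
    · have : -sin (c * t * X) / t ≤ -sin (c * t * X) / y :=
        div_le_div_of_nonneg_left (by linarith) hy0 hy1
      have : 0 ≤ c * (u * v * s ^ 2 / 23) := by positivity
      linarith
    · have hS1 : sin (c * t * X) ≤ c * t * s := by
        rcases le_total 0 X with hX0 | hX0
        · refine (sin_le (by positivity)).trans ?_
          exact mul_le_mul_of_nonneg_left (by linarith) hct0.le
        · have h1 : (c * t) ^ 2 ≤ 1 / 16 := by
            rw [mul_pow, hct]
            have : (1 - v) ^ 2 * (u * s) ≤ 1 * 16 :=
              mul_le_mul (pow_le_one₀ (by linarith) (by linarith)) hus (by positivity) zero_le_one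
            linarith
          have h2 : c * t ≤ 1 / 4 := le_of_sq_le_sq (by linarith) (by norm_num)
          have h3 : -1 ≤ c * t * X := by
            have : -2 ≤ X := by linarith
            linarith [mul_nonneg hct0.le (by linarith : 0 ≤ X + 2)]
          have := sin_nonpos_of_nonpos_of_neg_pi_le (x := c * t * X)
            (mul_nonpos_of_nonneg_of_nonpos hct0.le hX0) (by linarith [pi_gt_three])
          exact this.trans (by positivity)
      have h1 : sin (c * t * X) / y ≤ sin (c * t * X) * (1 + t ^ 2 / 23) / t := by
        rw [div_le_div_iff₀ hy0 ht]
        linarith [mul_le_mul_of_nonneg_left hy2 hS]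
      have h2 : sin (c * t * X) * (t ^ 2 / 23) / t ≤ c * (u * v * s ^ 2 / 23) := by
        calc _ ≤ c * t * s * (t ^ 2 / 23) / t := by gcongr
          _ = c * s * (t ^ 2 / 23) := by field_simp
          _ = _ := by rw [htt]; ring
      have h3 : sin (c * t * X) * (1 + t ^ 2 / 23) / t =
          sin (c * t * X) / t + sin (c * t * X) * (t ^ 2 / 23) / t := by ring
      rw [neg_div, neg_div]
      linarith
  refine le_trans ?_ hker
  obtain ⟨G, hG⟩ : ∃ G, G = (1 - v) ^ 2 * u * s / 256 := ⟨_, rfl⟩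
  have hG0 : 0 ≤ G := by rw [hG]; positivity
  have hsin : c * (-X + G * X ^ 3 / 6 - G ^ 2 * (max X 0) ^ 5 / 120) ≤ -sin (c * t * X) / t := by
    rw [le_div_iff₀ ht]
    refine le_trans (le_of_eq ?_) (le_neg_sin (c * t * X))
    have hm : max (c * t * X) 0 = c * t * max X 0 := by
      rw [mul_max_of_nonneg _ _ hct0.le, mul_zero]
    rw [hm, hG, ← hct]
    ring
  refine le_trans ?_ (sub_le_sub_right hsin _)
  rw [← mul_sub]
  refine mul_le_mul_of_nonneg_left ?_ hc.le
  have hγ : (1 - v) ^ 2 ≤ 1 := pow_le_one₀ (by linarith) (by linarith)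
  have hγ0 : 0 ≤ (1 - v) ^ 2 := by positivity
  -- the cubic term
  obtain ⟨D, hD⟩ : ∃ D, D = h * u + (1 - 3 * v) / 120 * u * s ^ 2 := ⟨_, rfl⟩
  have hD0 : 0 ≤ D := by
    have : 0 ≤ 1 - 3 * v := by linarith
    rw [hD]; positivity
  have hD1 : D ≤ u * (h + s ^ 2 / 120) := by
    rw [hD]
    have : 0 ≤ v * (u * s ^ 2) := by positivity
    linarith
  have hD2 : D ≤ 0.0185 + 0.134 * s := by
    have : u * s * s ≤ 16 * s := mul_le_mul_of_nonneg_right hus hs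
    linarith
  have hcube : (s - 1) ^ 3 - 3 * D * (s - 1) ^ 2 - 3.03 * D ^ 2 ≤ X ^ 3 := by
    have h1 : (s - 1 - D) ^ 3 ≤ X ^ 3 :=
      (Odd.strictMono_pow (by decide)).monotone (by rw [hX, hD]; linarith)
    have h2 : 0 ≤ D ^ 2 * (3 * s + 0.03 - D) := mul_nonneg (by positivity) (by linarith)
    linarith
  have hcub : (1 - v) ^ 2 / 1536 * u * (s ^ 4 - 3 * s ^ 3 + 3 * s ^ 2 - s) -
      u ^ 2 / 512 * (h + s ^ 2 / 120) * (s ^ 3 - 2 * s ^ 2 + s) -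
      u ^ 2 / 590 * (h ^ 2 * s + s ^ 5 / 14400) ≤ G * X ^ 3 / 6 := by
    have h1 := mul_le_mul_of_nonneg_left hcube hG0
    have h2 : (1 - v) ^ 2 * u * s * (D * (s - 1) ^ 2) ≤
        1 * u * s * (u * (h + s ^ 2 / 120) * (s - 1) ^ 2) := by gcongr
    have h3 : (1 - v) ^ 2 * u * s * D ^ 2 ≤ 1 * u * s * (u * (h + s ^ 2 / 120)) ^ 2 := by gcongr
    have h4 : 1 * u * s * (u * (h + s ^ 2 / 120)) ^ 2 ≤
        3 / 7 * u ^ 2 * (2 * (h ^ 2 * s + s ^ 5 / 14400)) := by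
      have h5 : (h + s ^ 2 / 120) ^ 2 ≤ 2 * (h ^ 2 + s ^ 4 / 14400) := by
        linarith [sq_nonneg (h - s ^ 2 / 120)]
      calc _ = u * (u ^ 2 * s * (h + s ^ 2 / 120) ^ 2) := by ring
        _ ≤ 3 / 7 * (u ^ 2 * s * (2 * (h ^ 2 + s ^ 4 / 14400))) := by gcongr
        _ = _ := by ring
    have h6 : 0 ≤ u ^ 2 * (h ^ 2 * s + s ^ 5 / 14400) := by positivity
    rw [hG] at h1 ⊢
    linarith
  have hquint : G ^ 2 * (max X 0) ^ 5 / 120 ≤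
      u ^ 2 * (s ^ 7 - 5 * s ^ 6 + 10 * s ^ 5) / 7864320 := by
    have h1 : (max X 0) ^ 5 ≤ (max (s - 1) 0) ^ 5 := by
      gcongr
      linarith
    have h2 : s ^ 2 * (max (s - 1) 0) ^ 5 ≤ s ^ 7 - 5 * s ^ 6 + 10 * s ^ 5 := by
      rcases le_total 1 s with h | h
      · rw [max_eq_left (by linarith)]
        linarith [mul_nonneg (pow_nonneg hs 2) (by nlinarith only [h] : 0 ≤ 10 * s ^ 2 - 5 * s + 1)]
      · rw [max_eq_right (by linarith)]
        have : 0 ≤ s ^ 5 * (s ^ 2 - 5 * s + 10) := mul_nonneg (by positivity) (by linarith [sq_nonneg s])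
        linarith
    have h3 : ((1 - v) ^ 2) ^ 2 ≤ 1 := pow_le_one₀ hγ0 hγ
    calc _ = ((1 - v) ^ 2) ^ 2 * (u ^ 2 * (s ^ 2 * (max X 0) ^ 5)) / 7864320 := by
          rw [hG]; ring
      _ ≤ 1 * (u ^ 2 * (s ^ 2 * (max (s - 1) 0) ^ 5)) / 7864320 := by gcongr
      _ ≤ 1 * (u ^ 2 * (s ^ 7 - 5 * s ^ 6 + 10 * s ^ 5)) / 7864320 := by gcongr
      _ = _ := by ring
  rw [minorant]
  linarith

/-- The polynomial majorant of the inversion integrand. -/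
noncomputable def majorant (u v h s : ℝ) : ℝ :=
  1 - h * u - s + (1 - 3 * v) / 120 * u * s ^ 2 +
    (1 - v) ^ 2 / 1536 * u * (s ^ 4 - 3 * s ^ 3 + 3 * s ^ 2 - s) +
    u ^ 2 / 512 * h * (s ^ 3 - 2 * s ^ 2 + s) + u ^ 2 / 512 * h ^ 2 * s ^ 2 +
    u ^ 2 * s ^ 2 / 7864320 + u * v * (s ^ 2 + s) / 23

theorem le_majorant {c t s u v h E : ℝ} (hc : 0 < c) (ht : 0 < t) (ht1 : t ≤ 4 / 5) (hs : 0 ≤ s)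
    (hu : 0 < u) (hu1 : u ≤ 3 / 7) (hv : 0 ≤ v) (hv1 : v ≤ 1 / 25) (hh : 0 ≤ h) (hh1 : h ≤ 0.043)
    (hct : c ^ 2 * t ^ 2 = (1 - v) ^ 2 * u * s / 256) (htt : t ^ 2 = s * u * v)
    (hE0 : 0 ≤ E) (hE1 : E ≤ s) (hE2 : s - (1 - 3 * v) / 120 * u * s ^ 2 ≤ E) :
    sin (c * t * (1 - h * u - E)) / (2 * sin (t / 2)) ≤ c * majorant u v h s := by
  obtain ⟨hy0, hy1, hy2⟩ := two_mul_sin_half_bounds ht ht1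
  generalize 2 * sin (t / 2) = y at *
  obtain ⟨X, hX⟩ : ∃ X, X = E - 1 + h * u := ⟨_, rfl⟩
  have hθ : c * t * (1 - h * u - E) = -(c * t * X) := by rw [hX]; ring
  rw [hθ, sin_neg]
  have hct0 : 0 < c * t := mul_pos hc ht
  have hhu : h * u ≤ 0.0185 := (mul_le_mul hh1 hu1 hu.le (by norm_num)).trans (by norm_num)
  have hhu0 : 0 ≤ h * u := by positivity
  have hker : -sin (c * t * X) / y ≤ -sin (c * t * X) / t + c * (u * v * (s ^ 2 + s) / 23) := by
    rcases le_total 0 (sin (c * t * X)) with hS | hS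
    · have : sin (c * t * X) / t ≤ sin (c * t * X) / y :=
        div_le_div_of_nonneg_left hS hy0 hy1
      have : 0 ≤ c * (u * v * (s ^ 2 + s) / 23) := by positivity
      rw [neg_div, neg_div]
      linarith
    · have hS1 : -sin (c * t * X) ≤ c * t * (s + 1) := by
        have h1 : |X| ≤ s + 1 := abs_le.2 ⟨by linarith, by linarith⟩
        calc _ ≤ |sin (c * t * X)| := neg_le_abs _
          _ ≤ |c * t * X| := abs_sin_le_abs
          _ = c * t * |X| := by rw [abs_mul, abs_of_pos hct0]
          _ ≤ _ := by gcongr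
      have h1 : -sin (c * t * X) / y ≤ -sin (c * t * X) * (1 + t ^ 2 / 23) / t := by
        rw [div_le_div_iff₀ hy0 ht]
        linarith [mul_le_mul_of_nonneg_left hy2 (neg_nonneg.2 hS)]
      have h2 : -sin (c * t * X) * (t ^ 2 / 23) / t ≤ c * (u * v * (s ^ 2 + s) / 23) := by
        calc _ ≤ c * t * (s + 1) * (t ^ 2 / 23) / t := by gcongr
          _ = c * (s + 1) * (t ^ 2 / 23) := by field_simp
          _ = _ := by rw [htt]; ring
      have h3 : -sin (c * t * X) * (1 + t ^ 2 / 23) / t =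
          -sin (c * t * X) / t + -sin (c * t * X) * (t ^ 2 / 23) / t := by ring
      linarith
  refine hker.trans ?_
  obtain ⟨G, hG⟩ : ∃ G, G = (1 - v) ^ 2 * u * s / 256 := ⟨_, rfl⟩
  have hG0 : 0 ≤ G := by rw [hG]; positivity
  have hsin : -sin (c * t * X) / t ≤ c * (-X + G * X ^ 3 / 6 + G ^ 2 * (max (-X) 0) ^ 5 / 120) := by
    rw [div_le_iff₀ ht]
    refine (neg_sin_le (c * t * X)).trans (le_of_eq ?_)
    have hm : max (-(c * t * X)) 0 = c * t * max (-X) 0 := by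
      rw [mul_max_of_nonneg _ _ hct0.le, mul_zero, mul_neg]
    rw [hm, hG, ← hct]
    ring
  refine (add_le_add hsin le_rfl).trans ?_
  rw [← mul_add]
  refine mul_le_mul_of_nonneg_left ?_ hc.le
  have hγ : (1 - v) ^ 2 ≤ 1 := pow_le_one₀ (by linarith) (by linarith)
  have hγ0 : 0 ≤ (1 - v) ^ 2 := by positivity
  have hcub : G * X ^ 3 / 6 ≤ (1 - v) ^ 2 / 1536 * u * (s ^ 4 - 3 * s ^ 3 + 3 * s ^ 2 - s) +
      u ^ 2 / 512 * h * (s ^ 3 - 2 * s ^ 2 + s) + u ^ 2 / 512 * h ^ 2 * s ^ 2 := by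
    have h1 : X ^ 3 ≤ (s - 1 + h * u) ^ 3 :=
      (Odd.strictMono_pow (by decide)).monotone (by rw [hX]; linarith)
    have h2 : (s - 1 + h * u) ^ 3 ≤
        (s - 1) ^ 3 + 3 * (h * u) * (s - 1) ^ 2 + 3 * (h * u) ^ 2 * s := by
      linarith [mul_nonneg (sq_nonneg (h * u)) (by linarith : 0 ≤ 3 - h * u)]
    have h3 := mul_le_mul_of_nonneg_left (h1.trans h2) hG0
    have h4 : (1 - v) ^ 2 * u * s * ((h * u) * (s - 1) ^ 2) ≤
        1 * u * s * ((h * u) * (s - 1) ^ 2) := by gcongr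
    have h5 : (1 - v) ^ 2 * u * s * ((h * u) ^ 2 * s) ≤ 1 * 1 * s * ((h * u) ^ 2 * s) := by
      gcongr
      linarith
    rw [hG] at h3 ⊢
    linarith
  have hquint : G ^ 2 * (max (-X) 0) ^ 5 / 120 ≤ u ^ 2 * s ^ 2 / 7864320 := by
    have h1 : (max (-X) 0) ^ 5 ≤ 1 :=
      pow_le_one₀ (le_max_right _ _) (max_le (by linarith) zero_le_one)
    have h3 : ((1 - v) ^ 2) ^ 2 ≤ 1 := pow_le_one₀ hγ0 hγ
    calc _ = ((1 - v) ^ 2) ^ 2 * (u ^ 2 * s ^ 2 * (max (-X) 0) ^ 5) / 7864320 := by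
          rw [hG]; ring
      _ ≤ 1 * (u ^ 2 * s ^ 2 * 1) / 7864320 := by gcongr
      _ = _ := by ring
  rw [majorant]
  linarith

end Pointwise

section Moments

open Real

variable {k : ℕ} {lam t : ℝ}

theorem continuous_damping (k : ℕ) (lam : ℝ) : Continuous (damping k lam) := by
  unfold damping; fun_prop

theorem continuous_dampingDeriv (k : ℕ) (lam : ℝ) : Continuous (dampingDeriv k lam) := by
  unfold dampingDeriv; fun_prop

theorem continuous_scaledSq (k : ℕ) (lam : ℝ) : Continuous (scaledSq k lam) := by
  unfold scaledSq; fun_prop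

/-- The moments of the damping weight over the central interval. -/
noncomputable def moment (k : ℕ) (lam : ℝ) (i : ℕ) : ℝ :=
  ∫ t in (0 : ℝ)..(4 / (2 * k + 1)), exp (-damping k lam t) * scaledSq k lam t ^ i

/-- The boundary term in the integration by parts for the moments. -/
noncomputable def boundaryTerm (k : ℕ) (lam : ℝ) (i : ℕ) : ℝ :=
  exp (-damping k lam (4 / (2 * k + 1))) * (4 / (2 * k + 1)) *
    scaledSq k lam (4 / (2 * k + 1)) ^ i

theorem continuous_moment_integrand (k : ℕ) (lam : ℝ) (i : ℕ) :
    Continuous fun t => exp (-damping k lam t) * scaledSq k lam t ^ i :=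
  ((continuous_damping k lam).neg.rexp).mul ((continuous_scaledSq k lam).pow i)

theorem scaledSq_nonneg (hl : 0 < lam) : 0 ≤ scaledSq k lam t := by
  rw [scaledSq_eq]; positivity

theorem moment_nonneg (hl : 0 < lam) (i : ℕ) : 0 ≤ moment k lam i :=
  intervalIntegral.integral_nonneg (by positivity) fun _ _ =>
    mul_nonneg (exp_pos _).le (pow_nonneg (scaledSq_nonneg hl) i)

theorem boundaryTerm_nonneg (hl : 0 < lam) (i : ℕ) : 0 ≤ boundaryTerm k lam i :=
  mul_nonneg (by positivity) (pow_nonneg (scaledSq_nonneg hl) i)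

theorem moment_by_parts (k : ℕ) (lam : ℝ) (i : ℕ) :
    (2 * i + 1) * moment k lam i =
      (∫ t in (0 : ℝ)..(4 / (2 * k + 1)),
        exp (-damping k lam t) * (dampingDeriv k lam t * scaledSq k lam t ^ i)) +
      boundaryTerm k lam i := by
  have hd : ∀ t ∈ Set.uIcc (0 : ℝ) (4 / (2 * k + 1)),
      HasDerivAt (fun t => exp (-damping k lam t) * t * scaledSq k lam t ^ i)
        ((2 * i + 1) * (exp (-damping k lam t) * scaledSq k lam t ^ i) -
          exp (-damping k lam t) * (dampingDeriv k lam t * scaledSq k lam t ^ i)) t := by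
    intro t _
    obtain ⟨q, hq⟩ : ∃ q, q = lam * (((2 * k + 1 : ℝ) ^ 2 - 1) * (2 * k + 1) / 24) := ⟨_, rfl⟩
    have hS : ∀ t, scaledSq k lam t = q * t ^ 2 := fun t => by rw [scaledSq, hq]
    have h1 := (hasDerivAt_damping k lam t).neg.exp
    have h2 := (hasDerivAt_pow (2 * i + 1) t).const_mul (q ^ i)
    have h3 := h1.mul h2
    refine (h3.congr_deriv ?_).congr_of_eventuallyEq (Filter.Eventually.of_forall fun x => ?_)
    · have hD : dampingDeriv k lam t =
          t * (lam * ∑ j ∈ Finset.range k, (((j : ℝ) + 1) * sin ((j + 1) * t))) := by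
        rw [dampingDeriv, mul_left_comm, Finset.mul_sum _ _ t]
        congr 1
        exact Finset.sum_congr rfl fun j _ => by ring
      rw [hD, hS]
      simp only [Pi.neg_apply, Nat.add_sub_cancel]
      push_cast
      ring
    · simp only [hS, Pi.mul_apply, Pi.neg_apply]
      ring
  have hc1 : Continuous fun t =>
      exp (-damping k lam t) * (dampingDeriv k lam t * scaledSq k lam t ^ i) :=
    ((continuous_damping k lam).neg.rexp).mul
      ((continuous_dampingDeriv k lam).mul ((continuous_scaledSq k lam).pow i))
  have hc2 := (continuous_moment_integrand k lam i).const_mul (2 * i + 1 : ℝ)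
  have h := intervalIntegral.integral_eq_sub_of_hasDerivAt hd
    ((hc2.sub hc1).intervalIntegrable _ _)
  rw [intervalIntegral.integral_sub (hc2.intervalIntegrable _ _) (hc1.intervalIntegrable _ _),
    intervalIntegral.integral_const_mul] at h
  rw [moment, boundaryTerm]
  linarith [h]

/-- Integrating a polynomial in `scaledSq` against the weight. -/
theorem integral_weight_mul_sum (k : ℕ) (lam : ℝ) {n : ℕ} (a : Fin n → ℝ) :
    (∫ t in (0 : ℝ)..(4 / (2 * k + 1)),
      exp (-damping k lam t) * ∑ i : Fin n, a i * scaledSq k lam t ^ (i : ℕ)) =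
      ∑ i : Fin n, a i * moment k lam i := by
  have : ∀ t, exp (-damping k lam t) * ∑ i : Fin n, a i * scaledSq k lam t ^ (i : ℕ) =
      ∑ i : Fin n, a i * (exp (-damping k lam t) * scaledSq k lam t ^ (i : ℕ)) := fun t => by
    rw [Finset.mul_sum]
    exact Finset.sum_congr rfl fun i _ => by ring
  simp only [this]
  rw [intervalIntegral.integral_finsetSum fun (i : Fin n) _ =>
    ((continuous_moment_integrand k lam i).const_mul (a i)).intervalIntegrable _ _]
  simp only [intervalIntegral.integral_const_mul, moment]

theorem integral_weight_mono (k : ℕ) (lam : ℝ) {f g : ℝ → ℝ} (hf : Continuous f)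
    (hg : Continuous g) (h : ∀ t : ℝ, 0 ≤ t → t ≤ 4 / (2 * k + 1) → f t ≤ g t) :
    (∫ t in (0 : ℝ)..(4 / (2 * k + 1)), exp (-damping k lam t) * f t) ≤
      ∫ t in (0 : ℝ)..(4 / (2 * k + 1)), exp (-damping k lam t) * g t := by
  have hW := (continuous_damping k lam).neg.rexp
  refine intervalIntegral.integral_mono_on (by positivity)
    ((hW.mul hf).intervalIntegrable _ _) ((hW.mul hg).intervalIntegrable _ _) fun t ht => ?_
  exact mul_le_mul_of_nonneg_left (h t ht.1 ht.2) (exp_pos _).le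

theorem integral_weight_mul_pow (k : ℕ) (lam : ℝ) (i : ℕ) :
    (∫ t in (0 : ℝ)..(4 / (2 * k + 1)), exp (-damping k lam t) * scaledSq k lam t ^ i) =
      moment k lam i := rfl

theorem moment_succ_le (hk : 2 ≤ k) (hl : 0 < lam) (i : ℕ) :
    moment k lam (i + 1) -
      (3 - 7 / (2 * k + 1) ^ 2) / 120 * ratioU k lam * moment k lam (i + 2) +
      boundaryTerm k lam i ≤ (2 * i + 1) * moment k lam i := by
  rw [moment_by_parts]
  refine add_le_add ?_ le_rfl
  have h1 : moment k lam (i + 1) -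
      (3 - 7 / (2 * k + 1) ^ 2) / 120 * ratioU k lam * moment k lam (i + 2) =
      ∫ t in (0 : ℝ)..(4 / (2 * k + 1)), exp (-damping k lam t) * (scaledSq k lam t ^ (i + 1) -
        (3 - 7 / (2 * k + 1) ^ 2) / 120 * ratioU k lam * scaledSq k lam t ^ (i + 2)) := by
    simp only [mul_sub, mul_left_comm (exp _)]
    rw [intervalIntegral.integral_sub
      ((continuous_moment_integrand k lam _).intervalIntegrable _ _)
      (((continuous_moment_integrand k lam _).const_mul _).intervalIntegrable _ _),
      intervalIntegral.integral_const_mul]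
    rfl
  rw [h1]
  have hS := continuous_scaledSq k lam
  refine integral_weight_mono k lam (by fun_prop)
    ((continuous_dampingDeriv k lam).mul (hS.pow i)) fun t ht _ => ?_
  have := mul_le_mul_of_nonneg_right (le_dampingDeriv (t := t) hk hl ht)
    (pow_nonneg (scaledSq_nonneg (k := k) (t := t) hl) i)
  refine le_trans (le_of_eq ?_) this
  ring

theorem le_moment_succ (hl : 0 < lam) (i : ℕ) :
    (2 * i + 1) * moment k lam i ≤ moment k lam (i + 1) + boundaryTerm k lam i := by
  rw [moment_by_parts]
  refine add_le_add ?_ le_rfl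
  have hS := continuous_scaledSq k lam
  refine integral_weight_mono k lam ((continuous_dampingDeriv k lam).mul (hS.pow i))
    (hS.pow (i + 1)) fun t ht _ => ?_
  rw [pow_succ']
  exact mul_le_mul_of_nonneg_right (dampingDeriv_le hl ht) (pow_nonneg (scaledSq_nonneg hl) i)

theorem moment_zero_le (hk : 2 ≤ k) (hl : 0 < lam) :
    moment k lam 0 ≤ moment k lam 1 -
      (3 - 7 / (2 * k + 1) ^ 2) / 120 * ratioU k lam * moment k lam 2 +
      ratioU k lam ^ 2 / 4480 * moment k lam 3 + boundaryTerm k lam 0 := by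
  have h0 := moment_by_parts k lam 0
  have h := integral_weight_mul_sum k lam
    ![0, 1, -((3 - 7 / (2 * k + 1) ^ 2) / 120 * ratioU k lam), ratioU k lam ^ 2 / 4480]
  have hS := continuous_scaledSq k lam
  have h2 : (∫ t in (0 : ℝ)..(4 / (2 * k + 1)),
      exp (-damping k lam t) * (dampingDeriv k lam t * scaledSq k lam t ^ 0)) ≤ _ :=
    (integral_weight_mono k lam ((continuous_dampingDeriv k lam).mul (hS.pow 0)) (by fun_prop)
    fun t ht _ => ?_).trans_eq h
  · simp [Fin.sum_univ_succ] at h2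
    simp at h0
    linarith
  · have := dampingDeriv_le' (t := t) hk hl ht
    simp [Fin.sum_univ_succ]
    linarith

theorem ratioU_pos (hk : 2 ≤ k) (hl : 0 < lam) : 0 < ratioU k lam := by
  have := sq_sub_one_pos hk
  rw [ratioU]
  positivity

theorem ratioU_mul_scaledSq_le (hk : 2 ≤ k) (hl : 0 < lam) (h0 : 0 ≤ t)
    (ht : t ≤ 4 / (2 * k + 1)) : ratioU k lam * scaledSq k lam t ≤ 16 := by
  rw [ratioU_mul_scaledSq hk hl, ← mul_pow]
  rw [le_div_iff₀ (by positivity)] at ht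
  calc _ ≤ (4 : ℝ) ^ 2 := by gcongr; linarith
    _ = 16 := by norm_num

theorem ratioU_mul_moment_succ_le (hk : 2 ≤ k) (hl : 0 < lam) (i : ℕ) :
    ratioU k lam * moment k lam (i + 1) ≤ 16 * moment k lam i := by
  have hS := continuous_scaledSq k lam
  have := integral_weight_mono k lam (f := fun t => ratioU k lam * scaledSq k lam t ^ (i + 1))
    (g := fun t => 16 * scaledSq k lam t ^ i) (by fun_prop) (by fun_prop) fun t h0 ht => by
      rw [pow_succ', ← mul_assoc]
      exact mul_le_mul_of_nonneg_right (ratioU_mul_scaledSq_le hk hl h0 ht)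
        (pow_nonneg (scaledSq_nonneg hl) i)
  simpa only [mul_left_comm (exp _), intervalIntegral.integral_const_mul,
    integral_weight_mul_pow] using this

/-- One step of the descending chain of moment ratio bounds. -/
theorem moment_ratio_step (hk : 2 ≤ k) (hl : 0 < lam) {r r' : ℝ} (i : ℕ)
    (h : ratioU k lam * moment k lam (i + 2) ≤ r * moment k lam (i + 1))
    (hr : 2 * i + 1 ≤ r' * (1 - r / 40)) (hr1 : r < 40) :
    moment k lam (i + 1) ≤ r' * moment k lam i := by
  have h1 := moment_succ_le hk hl i
  have h2 := boundaryTerm_nonneg (k := k) hl i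
  have h3 : 0 ≤ 7 / (2 * k + 1 : ℝ) ^ 2 * (ratioU k lam * moment k lam (i + 2)) :=
    mul_nonneg (by positivity) (mul_nonneg (ratioU_pos hk hl).le (moment_nonneg hl _))
  have h4 : (1 - r / 40) * moment k lam (i + 1) ≤ (2 * i + 1) * moment k lam i := by linarith
  have h5 := mul_le_mul_of_nonneg_right hr (moment_nonneg (k := k) hl i)
  have h6 : (1 - r / 40) * moment k lam (i + 1) ≤ (1 - r / 40) * (r' * moment k lam i) := by
    linarith
  exact le_of_mul_le_mul_left h6 (by linarith)

theorem ratioU_mul_le (hl : 0 < lam) (hu : ratioU k lam ≤ 3 / 7) {r : ℝ} {i : ℕ}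
    (h : moment k lam (i + 1) ≤ r * moment k lam i) :
    ratioU k lam * moment k lam (i + 1) ≤ 3 / 7 * r * moment k lam i := by
  rw [mul_assoc]
  exact mul_le_mul hu h (moment_nonneg hl _) (by norm_num)

theorem moment_ratios (hk : 2 ≤ k) (hl : 0 < lam) (hu : ratioU k lam ≤ 3 / 7) :
    moment k lam 1 ≤ 1.036 * moment k lam 0 ∧ moment k lam 2 ≤ 3.19 * moment k lam 1 ∧
    moment k lam 3 ≤ 5.47 * moment k lam 2 ∧ moment k lam 4 ≤ 7.9 * moment k lam 3 ∧
    moment k lam 5 ≤ 10.53 * moment k lam 4 ∧ moment k lam 6 ≤ 13.45 * moment k lam 5 ∧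
    moment k lam 7 ≤ 16.95 * moment k lam 6 := by
  have h9 := moment_ratio_step (r' := 28.4) hk hl 8 (ratioU_mul_moment_succ_le hk hl 9)
    (by norm_num) (by norm_num)
  have h8 := moment_ratio_step (r' := 21.6) hk hl 7 (ratioU_mul_le hl hu h9)
    (by norm_num) (by norm_num)
  have h7 := moment_ratio_step (r' := 16.95) hk hl 6 (ratioU_mul_le hl hu h8)
    (by norm_num) (by norm_num)
  have h6 := moment_ratio_step (r' := 13.45) hk hl 5 (ratioU_mul_le hl hu h7)
    (by norm_num) (by norm_num)
  have h5 := moment_ratio_step (r' := 10.53) hk hl 4 (ratioU_mul_le hl hu h6)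
    (by norm_num) (by norm_num)
  have h4 := moment_ratio_step (r' := 7.9) hk hl 3 (ratioU_mul_le hl hu h5)
    (by norm_num) (by norm_num)
  have h3 := moment_ratio_step (r' := 5.47) hk hl 2 (ratioU_mul_le hl hu h4)
    (by norm_num) (by norm_num)
  have h2 := moment_ratio_step (r' := 3.19) hk hl 1 (ratioU_mul_le hl hu h3)
    (by norm_num) (by norm_num)
  have h1 := moment_ratio_step (r' := 1.036) hk hl 0 (ratioU_mul_le hl hu h2)
    (by norm_num) (by norm_num)
  exact ⟨h1, h2, h3, h4, h5, h6, h7⟩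

theorem le_moment_zero (hk : 2 ≤ k) (hl : 0 < lam) (hu : ratioU k lam ≤ 3 / 7) :
    10 / 7 * (ratioU k lam / (2 * k + 1)) ≤ moment k lam 0 := by
  obtain ⟨u, hu0⟩ : ∃ u, u = ratioU k lam := ⟨_, rfl⟩
  obtain ⟨m, hm⟩ : ∃ m : ℝ, m = 2 * k + 1 := ⟨_, rfl⟩
  have hup : 0 < u := hu0 ▸ ratioU_pos hk hl
  have hmp : 0 < m := by rw [hm]; positivity
  rw [moment, ← hu0, ← hm]
  rw [← hu0] at hu
  have hW := continuous_moment_integrand k lam 0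
  have hS : ∀ t, scaledSq k lam t = m ^ 2 * t ^ 2 / u := fun t => by
    have := ratioU_mul_scaledSq (t := t) hk hl
    rw [← hu0, ← hm] at this
    rw [eq_div_iff hup.ne', mul_comm, this]
  have hle : 2 * u / m ≤ 4 / m := by gcongr; linarith
  have h1 : (∫ t in (0 : ℝ)..(2 * u / m), (1 - m ^ 2 / (2 * u) * t ^ 2)) =
      2 * u / m - m ^ 2 / (2 * u) * ((2 * u / m) ^ 3 / 3) := by
    rw [intervalIntegral.integral_sub intervalIntegrable_const ((by fun_prop : Continuous
      fun t : ℝ => m ^ 2 / (2 * u) * t ^ 2).intervalIntegrable _ _),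
      intervalIntegral.integral_const_mul, integral_pow]
    simp
    norm_num
  have h2 : (∫ t in (0 : ℝ)..(2 * u / m), (1 - m ^ 2 / (2 * u) * t ^ 2)) ≤
      ∫ t in (0 : ℝ)..(2 * u / m), exp (-damping k lam t) * scaledSq k lam t ^ 0 := by
    refine intervalIntegral.integral_mono_on (by positivity)
      ((by fun_prop : Continuous fun t : ℝ => 1 - m ^ 2 / (2 * u) * t ^ 2).intervalIntegrable _ _)
      (hW.intervalIntegrable _ _) fun t ht => ?_
    rw [pow_zero, mul_one]
    have e1 := add_one_le_exp (-damping k lam t)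
    have e2 := damping_le (k := k) (t := t) hl
    rw [hS] at e2
    have e3 : m ^ 2 * t ^ 2 / u / 2 = m ^ 2 / (2 * u) * t ^ 2 := by field_simp
    linarith
  have h3 : (∫ t in (0 : ℝ)..(2 * u / m), exp (-damping k lam t) * scaledSq k lam t ^ 0) ≤
      ∫ t in (0 : ℝ)..(4 / m), exp (-damping k lam t) * scaledSq k lam t ^ 0 := by
    refine intervalIntegral.integral_mono_interval le_rfl (by positivity) hle
      (Filter.Eventually.of_forall fun t => ?_) (hW.intervalIntegrable _ _)
    simpa using (exp_pos _).le
  refine le_trans ?_ (h2.trans h3)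
  rw [h1]
  have h4 : 2 * u / m - m ^ 2 / (2 * u) * ((2 * u / m) ^ 3 / 3) = (2 - 4 * u / 3) * (u / m) := by
    field_simp
    ring
  rw [h4]
  exact mul_le_mul_of_nonneg_right (by linarith) (by positivity)

end Moments

section Tail

open Real

theorem one_div_two_mul_sin_half_le {m t : ℝ} (hm : 5 ≤ m) (h0 : 4 / m ≤ t) (h1 : t ≤ π) :
    0 < 2 * sin (t / 2) ∧ 1 / (2 * sin (t / 2)) ≤ m / (4 - 8 / 3 * (1 / m ^ 2)) := by
  have hmp : 0 < m := by linarith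
  have e1 : 2 / m ≤ 2 / 5 := by gcongr
  have e2 : 2 / m ≤ t / 2 := by
    have : 4 / m = 2 * (2 / m) := by ring
    linarith
  have e3 : sin (2 / m) ≤ sin (t / 2) :=
    sin_le_sin_of_le_of_le_pi_div_two (by linarith [pi_gt_three, (by positivity : 0 < 2 / m)])
      (by linarith) e2
  have e4 := sin_ge_sub_cube (x := 2 / m) (by positivity)
  have e5 : (2 / m - (2 / m) ^ 3 / 6) = (2 - 4 / 3 * (1 / m ^ 2)) / m := by
    field_simp
    ring
  have e6 : 1 / m ^ 2 ≤ 1 / 25 := by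
    rw [show (25 : ℝ) = 5 ^ 2 by norm_num]
    gcongr
  have e7 : (4 - 8 / 3 * (1 / m ^ 2)) / m ≤ 2 * sin (t / 2) := by
    have : (4 - 8 / 3 * (1 / m ^ 2)) / m = 2 * ((2 - 4 / 3 * (1 / m ^ 2)) / m) := by ring
    linarith
  have e8 : 0 < 4 - 8 / 3 * (1 / m ^ 2) := by linarith
  have e9 : 0 < (4 - 8 / 3 * (1 / m ^ 2)) / m := by positivity
  refine ⟨by linarith, ?_⟩
  calc _ ≤ 1 / ((4 - 8 / 3 * (1 / m ^ 2)) / m) := one_div_le_one_div_of_le e9 e7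
    _ = _ := by rw [one_div_div]

theorem six_div_ratioU_le_damping {k : ℕ} {lam t : ℝ} (hk : 2 ≤ k) (hl : 0 < lam)
    (h0 : 4 / (2 * k + 1) ≤ t) (h1 : t ≤ π) : 6 / ratioU k lam ≤ damping k lam t := by
  have hk' : (2 : ℝ) ≤ k := by exact_mod_cast hk
  have hm : (5 : ℝ) ≤ 2 * k + 1 := by linarith
  obtain ⟨hy, hy1⟩ := one_div_two_mul_sin_half_le hm h0 h1
  have hd := sin_mul_eq_dirichlet k t
  have h2 : ∑ j ∈ Finset.range k, (1 - cos ((j + 1) * t)) =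
      (2 * k + 1) / 2 - sin ((k + 1 / 2) * t) * (1 / (2 * sin (t / 2))) := by
    rw [hd, mul_assoc, mul_one_div_cancel hy.ne', Finset.sum_sub_distrib]
    simp
    ring
  have h3 : sin ((k + 1 / 2) * t) * (1 / (2 * sin (t / 2))) ≤
      1 * ((2 * k + 1) / (4 - 8 / 3 * (1 / (2 * k + 1) ^ 2))) :=
    mul_le_mul (sin_le_one _) hy1 (by positivity) zero_le_one
  have h4 : 6 / ratioU k lam = lam * ((2 * k + 1) / 4 * (1 - 1 / (2 * k + 1 : ℝ) ^ 2)) := by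
    have := sq_sub_one_pos hk
    rw [ratioU]
    field_simp
    norm_num
  rw [h4, damping, h2]
  refine mul_le_mul_of_nonneg_left ?_ hl.le
  obtain ⟨m, hm'⟩ : ∃ m : ℝ, m = 2 * k + 1 := ⟨_, rfl⟩
  rw [← hm'] at h3 hm ⊢
  have e6 : 1 / m ^ 2 ≤ 1 / 25 := by
    rw [show (25 : ℝ) = 5 ^ 2 by norm_num]
    gcongr
  obtain ⟨v, hv⟩ : ∃ v, v = 1 / m ^ 2 := ⟨_, rfl⟩
  have hv0 : 0 ≤ v := by rw [hv]; positivity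
  rw [← hv] at h3 e6 ⊢
  have h5 : m / (4 - 8 / 3 * v) ≤ m / 4 * (1 + v) := by
    rw [div_le_iff₀ (by linarith)]
    have : 0 ≤ m * (v * (1 - 2 * v)) := mul_nonneg (by linarith) (mul_nonneg hv0 (by linarith))
    linarith
  linarith

theorem exp_neg_six_div_le {u : ℝ} (hu : 0 < u) (hu1 : u ≤ 3 / 7) :
    exp (-(6 / u)) ≤ 0.0000247 * u ^ 4 := by
  have hy : 14 ≤ 6 / u := by rw [le_div_iff₀ hu]; linarith
  have h1 : 6 / u / 14 ≤ exp ((6 / u - 14) / 4) := by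
    linarith [add_one_le_exp ((6 / u - 14) / 4)]
  have h2 : exp (6 / u) = exp 1 ^ 14 * exp ((6 / u - 14) / 4) ^ 4 := by
    rw [← exp_nat_mul, ← exp_nat_mul, ← exp_add]
    congr 1
    push_cast
    ring
  have h3 : (2.718 : ℝ) ^ 14 * (6 / u / 14) ^ 4 ≤ exp (6 / u) := by
    rw [h2]
    have := exp_one_gt_d9
    gcongr
    linarith
  rw [exp_neg]
  calc _ ≤ ((2.718 : ℝ) ^ 14 * (6 / u / 14) ^ 4)⁻¹ := by gcongr
    _ = ((2.718 : ℝ) ^ 14 * (6 / 14) ^ 4)⁻¹ * u ^ 4 := by field_simp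
    _ ≤ _ := by
      gcongr
      norm_num

theorem intervalIntegrable_inversionIntegrand (k : ℕ) {lam : ℝ} (hl : 0 ≤ lam) (x : ℝ) {a b : ℝ}
    (ha : 0 ≤ a) (hab : a ≤ b) (hb : b ≤ π) :
    IntervalIntegrable (inversionIntegrand k lam x) MeasureTheory.volume a b := by
  rw [intervalIntegrable_iff_integrableOn_Ioc_of_le hab]
  have hmeas : Measurable (inversionIntegrand k lam x) := by
    unfold inversionIntegrand
    fun_prop
  refine MeasureTheory.Measure.integrableOn_of_bounded (M := (lam *
    (∑ j ∈ Finset.range k, ((j : ℝ) + 1)) + |x|) * (π / 2)) (by simp)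
    hmeas.aestronglyMeasurable ?_
  refine (MeasureTheory.ae_restrict_iff' measurableSet_Ioc).2 (Filter.Eventually.of_forall ?_)
  intro t ht
  have ht0 : 0 < t := ha.trans_lt ht.1
  have h1 : t * 2 / π ≤ 2 * sin (t / 2) := by
    have := mul_le_sin (x := t / 2) (by linarith) (by linarith [ht.2])
    have e : t * 2 / π = 2 * (2 / π * (t / 2)) := by ring
    linarith
  have h2 : 0 < t * 2 / π := by positivity
  have h3 : |∑ j ∈ Finset.range k, sin ((j + 1) * t)| ≤
      ∑ j ∈ Finset.range k, ((j : ℝ) + 1) * t := by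
    refine (Finset.abs_sum_le_sum_abs _ _).trans (Finset.sum_le_sum fun j _ => ?_)
    exact abs_sin_le_abs.trans_eq (abs_of_nonneg (by positivity))
  have h4 : ∀ y, |sin (lam * y - x * t)| ≤ lam * |y| + |x| * t := fun y => by
    refine abs_sin_le_abs.trans ((abs_sub _ _).trans_eq ?_)
    rw [abs_mul, abs_mul, abs_of_nonneg hl, abs_of_pos ht0]
  rw [inversionIntegrand, norm_mul, norm_of_nonneg (exp_pos _).le, norm_div, norm_eq_abs,
    norm_of_nonneg (h2.le.trans h1)]
  have h5 : exp (-(lam * ∑ j ∈ Finset.range k, (1 - cos ((j + 1) * t)))) ≤ 1 := by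
    refine exp_le_one_iff.2 (neg_nonpos.2 (mul_nonneg hl (Finset.sum_nonneg fun j _ => ?_)))
    exact sub_nonneg.2 (cos_le_one _)
  refine (mul_le_of_le_one_left (div_nonneg (abs_nonneg _) (h2.le.trans h1)) h5).trans ?_
  calc _ ≤ (lam * (∑ j ∈ Finset.range k, ((j : ℝ) + 1) * t) + |x| * t) / (t * 2 / π) := by
        refine div_le_div₀ (by positivity) ((h4 _).trans ?_) h2 h1
        gcongr
    _ = _ := by
        rw [← Finset.sum_mul]
        field_simp

theorem abs_tail_le {k : ℕ} {lam : ℝ} (hk : 2 ≤ k) (hl : 0 < lam) (x : ℝ) :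
    |∫ t in (4 / (2 * k + 1))..π, inversionIntegrand k lam x t| ≤
      0.81 * (2 * k + 1) * exp (-(6 / ratioU k lam)) := by
  have hk' : (2 : ℝ) ≤ k := by exact_mod_cast hk
  have hm : (5 : ℝ) ≤ 2 * k + 1 := by linarith
  obtain ⟨m, hm'⟩ : ∃ m : ℝ, m = 2 * k + 1 := ⟨_, rfl⟩
  have hT : (4 : ℝ) / (2 * k + 1) ≤ π := by
    rw [div_le_iff₀ (by positivity)]
    nlinarith [pi_gt_three]
  have h := intervalIntegral.norm_integral_le_of_norm_le_const
    (C := exp (-(6 / ratioU k lam)) * (75 / 292 * (2 * k + 1)))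
    (f := inversionIntegrand k lam x) (a := 4 / (2 * k + 1)) (b := π) fun t ht => by
      rw [Set.uIoc_of_le hT] at ht
      obtain ⟨hy, hy1⟩ := one_div_two_mul_sin_half_le hm ht.1.le ht.2
      rw [inversionIntegrand, norm_mul, norm_of_nonneg (exp_pos _).le, norm_div,
        norm_of_nonneg hy.le, div_eq_mul_one_div]
      refine mul_le_mul (exp_le_exp.2 (neg_le_neg (six_div_ratioU_le_damping hk hl ht.1.le ht.2)))
        ?_ (by positivity) (exp_pos _).le
      refine (mul_le_mul (abs_sin_le_one _) hy1 (by positivity) zero_le_one).trans ?_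
      rw [← hm'] at hm ⊢
      have e6 : 1 / m ^ 2 ≤ 1 / 25 := by
        rw [show (25 : ℝ) = 5 ^ 2 by norm_num]
        gcongr
      rw [one_mul, div_le_iff₀ (by linarith)]
      nlinarith
  rw [norm_eq_abs] at h
  refine h.trans ?_
  have h2 : |π - 4 / (2 * k + 1)| ≤ 3.15 := by
    have : (0 : ℝ) ≤ 4 / (2 * k + 1) := by positivity
    rw [abs_of_nonneg (by linarith)]
    linarith [pi_lt_d2]
  calc _ ≤ exp (-(6 / ratioU k lam)) * (75 / 292 * (2 * k + 1)) * 3.15 := by gcongr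
    _ = 75 / 292 * 3.15 * (2 * k + 1) * exp (-(6 / ratioU k lam)) := by ring
    _ ≤ _ := by
      gcongr
      norm_num

end Tail

section Budget

theorem minorant_budget {u v h M0 M1 M2 M3 M4 M5 M6 M7 b2 b3 : ℝ} (hu : 0 < u)
    (hu1 : u ≤ 3 / 7) (hv : 0 ≤ v) (hv1 : v ≤ 1 / 25) (hh : 0.0416 ≤ h) (hh1 : h ≤ 0.043)
    (p0 : 0 ≤ M0) (p1 : 0 ≤ M1) (p2 : 0 ≤ M2)
    (r1 : M1 ≤ 1.036 * M0) (r2 : M2 ≤ 3.19 * M1) (r3 : M3 ≤ 5.47 * M2) (r4 : M4 ≤ 7.9 * M3)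
    (r5 : M5 ≤ 10.53 * M4) (r6 : M6 ≤ 13.45 * M5) (r7 : M7 ≤ 16.95 * M6)
    (q0 : M1 - (3 - 7 * v) / 120 * u * M2 ≤ M0) (q2 : 5 * M2 ≤ M3 + b2)
    (q3 : 7 * M3 ≤ M4 + b3) (hb2 : b2 ≤ 0.008 * M0) (hb3 : b3 ≤ 0.284 * M0) :
    0.0026 * u * M0 ≤ (1 + h * u) * M0 - (1 + (1 - v) ^ 2 / 1536 * u + u ^ 2 * h / 512 +
      u ^ 2 * h ^ 2 / 590) * M1 + ((1 - 3 * v) / 120 * u + 3 * ((1 - v) ^ 2 / 1536 * u) +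
      2 * (u ^ 2 * h / 512) - u * v / 23) * M2 - (u ^ 2 / 26880 + 3 * ((1 - v) ^ 2 / 1536 * u) +
      u ^ 2 * h / 512 + u ^ 2 / 61440) * M3 + ((1 - v) ^ 2 / 1536 * u + 2 * (u ^ 2 / 61440)) * M4 -
      (u ^ 2 / 61440 + u ^ 2 / 8496000 + 10 * (u ^ 2 / 7864320)) * M5 +
      5 * (u ^ 2 / 7864320) * M6 - u ^ 2 / 7864320 * M7 := by
  have hF : 0.0297 * M0 ≤ h * M0 - (2 - 4 * v) / 120 * M2 +
      (1 - v) ^ 2 / 1536 * (M4 - 3 * M3 + 3 * M2 - M1) - v * M2 / 23 := by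
    have e1 : (1 - v) ^ 2 / 1536 * (23 * M2 - 4 * b2 - b3 - M1) ≤
        (1 - v) ^ 2 / 1536 * (M4 - 3 * M3 + 3 * M2 - M1) :=
      mul_le_mul_of_nonneg_left (by linarith) (by positivity)
    have e2 : (1 - v) ^ 2 / 1536 * (4 * b2 + b3 + M1) ≤ 1 / 1536 * (1.352 * M0) := by
      refine (mul_le_mul_of_nonneg_left (by linarith : _ ≤ 1.352 * M0) (by positivity)).trans ?_
      gcongr
      exact pow_le_one₀ (by linarith) (by linarith)
    have e3 : (1 - 2 * v) * M2 ≤ (1 - v) ^ 2 * M2 := by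
      gcongr
      linarith [sq_nonneg v]
    have e4 : v * M2 ≤ 1 / 25 * M2 := mul_le_mul_of_nonneg_right hv1 p2
    have e5 := mul_le_mul_of_nonneg_right hh p0
    linarith
  have hG : M3 / 26880 + h / 512 * (M3 - 2 * M2 + M1) + (M5 - 2 * M4 + M3) / 61440 +
      h ^ 2 / 590 * M1 + M5 / 8496000 + (M7 - 5 * M6 + 10 * M5) / 7864320 ≤ 0.0548 * M0 := by
    have e1 : h * (M3 - 2 * M2 + M1) ≤ 0.043 * (12.6 * M0) :=
      (mul_le_mul_of_nonneg_left (by linarith) (by linarith)).trans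
        (mul_le_mul_of_nonneg_right hh1 (by linarith))
    have e2 : h ^ 2 * M1 ≤ 0.043 ^ 2 * (1.036 * M0) :=
      mul_le_mul (by gcongr) r1 p1 (by norm_num)
    linarith
  have hN : 0 ≤ u * (h * M0 - (2 - 4 * v) / 120 * M2 +
      (1 - v) ^ 2 / 1536 * (M4 - 3 * M3 + 3 * M2 - M1) - v * M2 / 23 -
      u * (M3 / 26880 + h / 512 * (M3 - 2 * M2 + M1) + (M5 - 2 * M4 + M3) / 61440 +
      h ^ 2 / 590 * M1 + M5 / 8496000 + (M7 - 5 * M6 + 10 * M5) / 7864320) - 0.0026 * M0) := by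
    refine mul_nonneg hu.le ?_
    have e1 := mul_le_mul_of_nonneg_left hG hu.le
    have e2 : u * (0.0548 * M0) ≤ 3 / 7 * (0.0548 * M0) := by gcongr
    linarith
  linarith

theorem majorant_budget {u v h M0 M1 M2 M3 M4 b0 : ℝ} (hu : 0 < u)
    (hu1 : u ≤ 3 / 7) (hv : 0 ≤ v) (hv1 : v ≤ 1 / 25) (hh : 0.033 ≤ h) (hh1 : h ≤ 0.043)
    (p0 : 0 ≤ M0) (p1 : 0 ≤ M1) (p2 : 0 ≤ M2)
    (r1 : M1 ≤ 1.036 * M0) (r2 : M2 ≤ 3.19 * M1) (r3 : M3 ≤ 5.47 * M2) (r4 : M4 ≤ 7.9 * M3)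
    (q0 : M0 ≤ M1 - (3 - 7 * v) / 120 * u * M2 + u ^ 2 / 4480 * M3 + b0)
    (hb0 : b0 ≤ 0.0001 * u * M0) :
    (1 - h * u) * M0 + (-1 - (1 - v) ^ 2 / 1536 * u + u ^ 2 * h / 512 + u * v / 23) * M1 +
      ((1 - 3 * v) / 120 * u + 3 * ((1 - v) ^ 2 / 1536 * u) - 2 * (u ^ 2 * h / 512) +
      u ^ 2 * h ^ 2 / 512 + u ^ 2 / 7864320 + u * v / 23) * M2 +
      (-3 * ((1 - v) ^ 2 / 1536 * u) + u ^ 2 * h / 512) * M3 + (1 - v) ^ 2 / 1536 * u * M4 ≤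
      -0.0026 * u * M0 := by
  have hγ : (1 - v) ^ 2 ≤ 1 := pow_le_one₀ (by linarith) (by linarith)
  have hF : -h * M0 - (2 - 4 * v) / 120 * M2 +
      (1 - v) ^ 2 / 1536 * (M4 - 3 * M3 + 3 * M2 - M1) + v * (M2 + M1) / 23 ≤ -0.010 * M0 := by
    have e0 : M4 - 3 * M3 + 3 * M2 - M1 ≤ 23 * M2 + 23 * M0 := by linarith
    have e1 : (1 - v) ^ 2 / 1536 * (M4 - 3 * M3 + 3 * M2 - M1) ≤
        (1 - v) ^ 2 / 1536 * (23 * M2 + 23 * M0) := mul_le_mul_of_nonneg_left e0 (by positivity)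
    have e2 : (1 - v) ^ 2 * M0 ≤ 1 * M0 := by gcongr
    have e3 : (1 - v) ^ 2 * M2 ≤ (1 - v) * M2 := by
      refine mul_le_mul_of_nonneg_right ?_ p2
      nlinarith
    have e4 : v * M2 ≤ 1 / 25 * M2 := mul_le_mul_of_nonneg_right hv1 p2
    have e4' : v * M1 ≤ 1 / 25 * M1 := mul_le_mul_of_nonneg_right hv1 p1
    have e5 := mul_le_mul_of_nonneg_right hh p0
    linarith
  have hG : M3 / 4480 + h / 512 * (M3 - 2 * M2 + M1) + h ^ 2 / 512 * M2 + M2 / 7864320 ≤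
      0.006 * M0 := by
    have e1 : h * (M3 - 2 * M2 + M1) ≤ 0.043 * (12.6 * M0) :=
      (mul_le_mul_of_nonneg_left (by linarith) (by linarith)).trans
        (mul_le_mul_of_nonneg_right hh1 (by linarith))
    have e2 : h ^ 2 * M2 ≤ 0.043 ^ 2 * (3.31 * M0) :=
      mul_le_mul (by gcongr) (by linarith) p2 (by norm_num)
    linarith
  have hN : 0 ≤ u * (-(-h * M0 - (2 - 4 * v) / 120 * M2 +
      (1 - v) ^ 2 / 1536 * (M4 - 3 * M3 + 3 * M2 - M1) + v * (M2 + M1) / 23) -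
      u * (M3 / 4480 + h / 512 * (M3 - 2 * M2 + M1) + h ^ 2 / 512 * M2 + M2 / 7864320) -
      0.0027 * M0) := by
    refine mul_nonneg hu.le ?_
    have e1 := mul_le_mul_of_nonneg_left hG hu.le
    have e2 : u * (0.006 * M0) ≤ 3 / 7 * (0.006 * M0) := by gcongr
    linarith
  linarith

end Budget

section HalfBounds

open Real

variable {k : ℕ} {lam : ℝ}

theorem skewC_pos (hk : 2 ≤ k) : 0 < skewC k := by
  have h24 := sq_sub_one_pos hk
  rw [skewC]
  positivity

theorem one_div_sq_le (hk : 2 ≤ k) : (1 : ℝ) / (2 * k + 1) ^ 2 ≤ 1 / 25 := by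
  have hk' : (2 : ℝ) ≤ k := by exact_mod_cast hk
  gcongr
  nlinarith

theorem boundaryTerm_le (hk : 2 ≤ k) (hl : 0 < lam) (hu : ratioU k lam ≤ 3 / 7) (i : ℕ) :
    boundaryTerm k lam i ≤
      0.0000692 * ratioU k lam ^ 3 * (16 / ratioU k lam) ^ i * moment k lam 0 := by
  have hm := le_moment_zero hk hl hu
  have hup := ratioU_pos hk hl
  have hS : scaledSq k lam (4 / (2 * k + 1)) = 16 / ratioU k lam := by
    rw [eq_div_iff hup.ne', mul_comm, ratioU_mul_scaledSq hk hl]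
    field_simp
    norm_num
  have hT : (4 : ℝ) / (2 * k + 1) ≤ π := by
    have hk' : (2 : ℝ) ≤ k := by exact_mod_cast hk
    rw [div_le_iff₀ (by positivity)]
    nlinarith [pi_gt_three]
  have h1 : exp (-damping k lam (4 / (2 * k + 1))) ≤ 0.0000247 * ratioU k lam ^ 4 :=
    (exp_le_exp.2 (neg_le_neg (six_div_ratioU_le_damping hk hl le_rfl hT))).trans
      (exp_neg_six_div_le hup hu)
  rw [boundaryTerm, hS]
  calc _ ≤ 0.0000247 * ratioU k lam ^ 4 * (4 / (2 * k + 1)) * (16 / ratioU k lam) ^ i := by gcongr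
    _ = 0.00006916 * ratioU k lam ^ 3 * (16 / ratioU k lam) ^ i *
        (10 / 7 * (ratioU k lam / (2 * k + 1))) := by
      field_simp
      norm_num
    _ ≤ 0.0000692 * ratioU k lam ^ 3 * (16 / ratioU k lam) ^ i * moment k lam 0 := by
      gcongr
      norm_num

theorem tail_lt (hk : 2 ≤ k) (hl : 1 ≤ lam) (hu : ratioU k lam ≤ 3 / 7) :
    0.81 * (2 * k + 1) * exp (-(6 / ratioU k lam)) <
      skewC k * (0.0026 * ratioU k lam * moment k lam 0) := by
  have hl0 : 0 < lam := by linarith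
  have hm := le_moment_zero hk hl0 hu
  have hup := ratioU_pos hk hl0
  have h24 := sq_sub_one_pos hk
  have hum : ratioU k lam * (2 * k + 1) ≤ 25 := by
    rw [ratioU, div_mul_eq_mul_div, div_le_iff₀ (by positivity)]
    nlinarith
  have hc : 0.06 * (2 * k + 1) ≤ skewC k := by
    rw [skewC, le_div_iff₀ (by positivity)]
    nlinarith
  obtain ⟨u, hu0⟩ : ∃ u, u = ratioU k lam := ⟨_, rfl⟩
  obtain ⟨m, hm0⟩ : ∃ m : ℝ, m = 2 * k + 1 := ⟨_, rfl⟩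
  have hmp : 0 < m := by rw [hm0]; positivity
  simp only [← hu0, ← hm0] at hm hum hup hu hc ⊢
  calc _ ≤ 0.81 * m * (0.0000247 * u ^ 4) := by
        gcongr
        exact exp_neg_six_div_le hup hu
    _ = 0.000020007 * (u * m) * u * u ^ 2 := by ring
    _ ≤ 0.000020007 * 25 * (3 / 7) * u ^ 2 := by gcongr
    _ < 0.06 * (0.0026 * (10 / 7)) * u ^ 2 :=
        mul_lt_mul_of_pos_right (by norm_num) (by positivity)
    _ = 0.06 * m * (0.0026 * u * (10 / 7 * (u / m))) := by field_simp
    _ ≤ _ := by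
      have hc0 := (skewC_pos hk).le
      gcongr

/-- The central part of the phase written through the rescaled variables. -/
theorem inversionIntegrand_eq (x t : ℝ) {y E : ℝ}
    (hx : k * (k + 1) / 2 * lam - x = skewC k * y)
    (hE : phaseDefect k lam t = skewC k * t * E) :
    inversionIntegrand k lam x t =
      exp (-damping k lam t) * (sin (skewC k * t * (y - E)) / (2 * sin (t / 2))) := by
  have h : lam * (∑ j ∈ Finset.range k, sin ((j + 1) * t)) - x * t = skewC k * t * (y - E) := by
    rw [phaseDefect, Finset.sum_sub_distrib, ← Finset.sum_mul, sum_succ_pow_one] at hE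
    linear_combination t * hx - hE
  rw [inversionIntegrand, h, damping]

theorem integral_split (hk : 2 ≤ k) (hl : 0 < lam) (x : ℝ) :
    ∫ t in (0 : ℝ)..π, inversionIntegrand k lam x t =
      (∫ t in (0 : ℝ)..(4 / (2 * k + 1)), inversionIntegrand k lam x t) +
        ∫ t in (4 / (2 * k + 1))..π, inversionIntegrand k lam x t := by
  have hT : (4 : ℝ) / (2 * k + 1) ≤ π := by
    have hk' : (2 : ℝ) ≤ k := by exact_mod_cast hk
    rw [div_le_iff₀ (by positivity)]
    nlinarith [pi_gt_three]
  exact (intervalIntegral.integral_add_adjacent_intervals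
    (intervalIntegrable_inversionIntegrand k hl.le x le_rfl (by positivity) hT)
    (intervalIntegrable_inversionIntegrand k hl.le x (by positivity) hT le_rfl)).symm

/-- The facts about the rescaled variables used by the pointwise bounds. -/
theorem rescaled_facts (hk : 2 ≤ k) (hl : 0 < lam) {t : ℝ} (ht : 0 < t)
    (ht1 : t < 4 / (2 * k + 1)) :
    0 < skewC k ∧ t ≤ 4 / 5 ∧ (1 : ℝ) / (2 * k + 1) ^ 2 ≤ 1 / 25 ∧
    skewC k ^ 2 * t ^ 2 =
      (1 - 1 / (2 * k + 1) ^ 2) ^ 2 * ratioU k lam * scaledSq k lam t / 256 ∧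
    t ^ 2 = scaledSq k lam t * ratioU k lam * (1 / (2 * k + 1) ^ 2) := by
  have h24 := sq_sub_one_pos hk
  have hk' : (2 : ℝ) ≤ k := by exact_mod_cast hk
  have hus := ratioU_mul_scaledSq (t := t) hk hl
  refine ⟨by rw [skewC]; positivity, ht1.le.trans ?_, ?_, ?_, ?_⟩
  · gcongr
    linarith
  · gcongr
    linarith
  · rw [mul_assoc (_ ^ 2), hus, skewC]
    field_simp
    norm_num
  · rw [mul_comm (scaledSq _ _ _), hus]
    field_simp

theorem exists_phaseDefect_eq (hk : 2 ≤ k) (hl : 0 < lam) {t : ℝ} (ht : 0 < t) :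
    ∃ E, phaseDefect k lam t = skewC k * t * E ∧ 0 ≤ E ∧ E ≤ scaledSq k lam t ∧
      scaledSq k lam t - (1 - 3 * (1 / (2 * k + 1) ^ 2)) / 120 * ratioU k lam *
        scaledSq k lam t ^ 2 ≤ E ∧
      E ≤ scaledSq k lam t - (1 - 3 * (1 / (2 * k + 1) ^ 2)) / 120 * ratioU k lam *
        scaledSq k lam t ^ 2 + ratioU k lam ^ 2 * scaledSq k lam t ^ 3 / 26880 := by
  have h24 := sq_sub_one_pos hk
  have hc : 0 < skewC k * t := mul_pos (by rw [skewC]; positivity) ht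
  refine ⟨phaseDefect k lam t / (skewC k * t), (mul_div_cancel₀ _ hc.ne').symm, ?_, ?_, ?_, ?_⟩
  · exact div_nonneg (phaseDefect_nonneg hl ht.le) hc.le
  · rw [div_le_iff₀' hc]
    exact phaseDefect_le hk hl ht.le
  · rw [le_div_iff₀' hc, mul_one_div]
    exact le_phaseDefect hk hl ht.le
  · rw [div_le_iff₀' hc, mul_one_div]
    exact phaseDefect_le' hk hl ht.le

theorem minorant_eq_sum (u v h s : ℝ) :
    minorant u v h s = ∑ i : Fin 8, ![1 + h * u,
      -(1 + (1 - v) ^ 2 / 1536 * u + u ^ 2 * h / 512 + u ^ 2 * h ^ 2 / 590),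
      (1 - 3 * v) / 120 * u + 3 * ((1 - v) ^ 2 / 1536 * u) + 2 * (u ^ 2 * h / 512) - u * v / 23,
      -(u ^ 2 / 26880 + 3 * ((1 - v) ^ 2 / 1536 * u) + u ^ 2 * h / 512 + u ^ 2 / 61440),
      (1 - v) ^ 2 / 1536 * u + 2 * (u ^ 2 / 61440),
      -(u ^ 2 / 61440 + u ^ 2 / 8496000 + 10 * (u ^ 2 / 7864320)),
      5 * (u ^ 2 / 7864320), -(u ^ 2 / 7864320)] i * s ^ (i : ℕ) := by
  simp [Fin.sum_univ_succ, minorant]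
  ring

theorem majorant_eq_sum (u v h s : ℝ) :
    majorant u v h s = ∑ i : Fin 5, ![1 - h * u,
      -1 - (1 - v) ^ 2 / 1536 * u + u ^ 2 * h / 512 + u * v / 23,
      (1 - 3 * v) / 120 * u + 3 * ((1 - v) ^ 2 / 1536 * u) - 2 * (u ^ 2 * h / 512) +
        u ^ 2 * h ^ 2 / 512 + u ^ 2 / 7864320 + u * v / 23,
      -3 * ((1 - v) ^ 2 / 1536 * u) + u ^ 2 * h / 512, (1 - v) ^ 2 / 1536 * u] i *
        s ^ (i : ℕ) := by
  simp [Fin.sum_univ_succ, majorant]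
  ring

theorem cdf_lt_half (hk : 2 ≤ k) (hl : 1 ≤ lam) (hu : ratioU k lam ≤ 3 / 7) (ν : ℕ) {h : ℝ}
    (hh : 0.0416 ≤ h) (hh1 : h ≤ 0.043)
    (hx : k * (k + 1) / 2 * lam - (ν + 1 / 2) = skewC k * (1 + h * ratioU k lam)) :
    ∑ j ∈ Finset.range (ν + 1), poissonOrderKPmf k lam j < 1 / 2 := by
  have hl0 : 0 < lam := by linarith
  have hup := ratioU_pos hk hl0
  have hcont := continuous_scaledSq k lam
  have hmono : (∫ t in (0 : ℝ)..(4 / (2 * k + 1)), exp (-damping k lam t) *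
      (skewC k * minorant (ratioU k lam) (1 / (2 * k + 1) ^ 2) h (scaledSq k lam t))) ≤
      ∫ t in (0 : ℝ)..(4 / (2 * k + 1)), inversionIntegrand k lam (ν + 1 / 2) t := by
    refine intervalIntegral.integral_mono_on_of_le_Ioo (by positivity)
      (Continuous.intervalIntegrable ?_ _ _) ?_ fun t ht => ?_
    · have := continuous_damping k lam
      unfold minorant
      fun_prop
    · exact intervalIntegrable_inversionIntegrand k hl0.le _ le_rfl (by positivity) (by
        have hk' : (2 : ℝ) ≤ k := by exact_mod_cast hk
        rw [div_le_iff₀ (by positivity)]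
        nlinarith [pi_gt_three])
    · obtain ⟨E, hE, e0, e1, e2, e3⟩ := exists_phaseDefect_eq hk hl0 ht.1
      obtain ⟨c0, t1, v1, ct, tt⟩ := rescaled_facts hk hl0 ht.1 ht.2
      rw [inversionIntegrand_eq _ _ hx hE]
      exact mul_le_mul_of_nonneg_left (minorant_le c0 ht.1 t1 (scaledSq_nonneg hl0) hup hu
        (by positivity) v1 (by linarith) hh1 ct (ratioU_mul_scaledSq_le hk hl0 ht.1.le ht.2.le)
        tt e0 e1 e2 e3) (exp_pos _).le
  simp only [minorant_eq_sum, mul_left_comm (exp _) (skewC k)] at hmono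
  rw [intervalIntegral.integral_const_mul, integral_weight_mul_sum] at hmono
  obtain ⟨r1, r2, r3, r4, r5, r6, r7⟩ := moment_ratios hk hl0 hu
  have hv1 : (1 : ℝ) / (2 * k + 1) ^ 2 ≤ 1 / 25 := one_div_sq_le hk
  have hb2 := boundaryTerm_le hk hl0 hu 2
  have hb3 := boundaryTerm_le hk hl0 hu 3
  have p0 := moment_nonneg (k := k) hl0 0
  have hbud := minorant_budget hup hu (by positivity) hv1 hh hh1 p0
    (moment_nonneg hl0 1) (moment_nonneg hl0 2) r1 r2 r3 r4 r5 r6 r7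
    (b2 := boundaryTerm k lam 2) (b3 := boundaryTerm k lam 3) ?_ ?_ ?_ (hb2.trans ?_) (hb3.trans ?_)
  · have hc : 0 < skewC k := skewC_pos hk
    have h1 := mul_le_mul_of_nonneg_left hbud hc.le
    have h2 := tail_lt hk hl hu
    have h3 := neg_abs_le (∫ t in (4 / (2 * k + 1 : ℝ))..π, inversionIntegrand k lam (ν + 1 / 2) t)
    have h4 := abs_tail_le hk hl0 (ν + 1 / 2)
    have h5 := integral_inversionIntegrand k hl0.le ν
    rw [integral_split hk hl0] at h5
    generalize (∫ t in (0 : ℝ)..(4 / (2 * k + 1)), inversionIntegrand k lam (ν + 1 / 2) t) = I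
      at hmono h5
    generalize (∫ t in (4 / (2 * k + 1 : ℝ))..π, inversionIntegrand k lam (ν + 1 / 2) t) = J
      at h3 h4 h5
    generalize (1 : ℝ) / (2 * k + 1) ^ 2 = v at hmono h1
    simp [Fin.sum_univ_succ] at hmono
    have h6 : 0 < π / 2 * (1 - 2 * ∑ j ∈ Finset.range (ν + 1), poissonOrderKPmf k lam j) := by
      rw [← h5]
      linarith
    linarith [pos_of_mul_pos_right h6 (by positivity)]
  · have h1 := moment_succ_le hk hl0 0
    have h2 := boundaryTerm_nonneg (k := k) hl0 0
    rw [mul_one_div]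
    norm_num at h1
    linarith
  · have := le_moment_succ (k := k) hl0 2
    norm_num at this
    linarith
  · have := le_moment_succ (k := k) hl0 3
    norm_num at this
    linarith
  · refine mul_le_mul_of_nonneg_right ?_ p0
    have : 0.0000692 * ratioU k lam ^ 3 * (16 / ratioU k lam) ^ 2 =
      0.0177152 * ratioU k lam := by field_simp; norm_num
    linarith
  · refine mul_le_mul_of_nonneg_right (le_of_eq_of_le ?_ (by norm_num : (0.2834432 : ℝ) ≤ _)) p0
    field_simp
    norm_num

theorem half_lt_cdf (hk : 2 ≤ k) (hl : 1 ≤ lam) (hu : ratioU k lam ≤ 3 / 7) (ν : ℕ) {h : ℝ}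
    (hh : 0.033 ≤ h) (hh1 : h ≤ 0.043)
    (hx : k * (k + 1) / 2 * lam - (ν + 1 / 2) = skewC k * (1 - h * ratioU k lam)) :
    1 / 2 < ∑ j ∈ Finset.range (ν + 1), poissonOrderKPmf k lam j := by
  have hl0 : 0 < lam := by linarith
  have hup := ratioU_pos hk hl0
  have hcont := continuous_scaledSq k lam
  have hmono : (∫ t in (0 : ℝ)..(4 / (2 * k + 1)), inversionIntegrand k lam (ν + 1 / 2) t) ≤
      ∫ t in (0 : ℝ)..(4 / (2 * k + 1)), exp (-damping k lam t) *
      (skewC k * majorant (ratioU k lam) (1 / (2 * k + 1) ^ 2) h (scaledSq k lam t)) := by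
    refine intervalIntegral.integral_mono_on_of_le_Ioo (by positivity)
      ?_ (Continuous.intervalIntegrable ?_ _ _) fun t ht => ?_
    · exact intervalIntegrable_inversionIntegrand k hl0.le _ le_rfl (by positivity) (by
        have hk' : (2 : ℝ) ≤ k := by exact_mod_cast hk
        rw [div_le_iff₀ (by positivity)]
        nlinarith [pi_gt_three])
    · have := continuous_damping k lam
      unfold majorant
      fun_prop
    · obtain ⟨E, hE, e0, e1, e2, e3⟩ := exists_phaseDefect_eq hk hl0 ht.1
      obtain ⟨c0, t1, v1, ct, tt⟩ := rescaled_facts hk hl0 ht.1 ht.2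
      rw [inversionIntegrand_eq _ _ hx hE]
      exact mul_le_mul_of_nonneg_left (le_majorant c0 ht.1 t1 (scaledSq_nonneg hl0) hup hu
        (by positivity) v1 (by linarith) hh1 ct tt e0 e1 e2) (exp_pos _).le
  simp only [majorant_eq_sum, mul_left_comm (exp _) (skewC k)] at hmono
  rw [intervalIntegral.integral_const_mul, integral_weight_mul_sum] at hmono
  obtain ⟨r1, r2, r3, r4, -, -, -⟩ := moment_ratios hk hl0 hu
  have hv1 : (1 : ℝ) / (2 * k + 1) ^ 2 ≤ 1 / 25 := one_div_sq_le hk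
  have hb0 := boundaryTerm_le hk hl0 hu 0
  have p := moment_nonneg (k := k) hl0
  have hbud := majorant_budget hup hu (by positivity) hv1 hh hh1 (p 0) (p 1) (p 2)
    r1 r2 r3 r4 (b0 := boundaryTerm k lam 0) ?_ (hb0.trans ?_)
  · have hc : 0 < skewC k := skewC_pos hk
    have h1 := mul_le_mul_of_nonneg_left hbud hc.le
    have h2 := tail_lt hk hl hu
    have h3 := le_abs_self (∫ t in (4 / (2 * k + 1 : ℝ))..π, inversionIntegrand k lam (ν + 1 / 2) t)
    have h4 := abs_tail_le hk hl0 (ν + 1 / 2)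
    have h5 := integral_inversionIntegrand k hl0.le ν
    rw [integral_split hk hl0] at h5
    generalize (∫ t in (0 : ℝ)..(4 / (2 * k + 1)), inversionIntegrand k lam (ν + 1 / 2) t) = I
      at hmono h5
    generalize (∫ t in (4 / (2 * k + 1 : ℝ))..π, inversionIntegrand k lam (ν + 1 / 2) t) = J
      at h3 h4 h5
    generalize (1 : ℝ) / (2 * k + 1) ^ 2 = v at hmono h1
    simp [Fin.sum_univ_succ] at hmono
    have h6 : 0 < π / 2 * (2 * ∑ j ∈ Finset.range (ν + 1), poissonOrderKPmf k lam j - 1) := by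
      linarith
    linarith [pos_of_mul_pos_right h6 (by positivity)]
  · have h1 := moment_zero_le hk hl0
    rw [mul_one_div]
    linarith
  · refine mul_le_mul_of_nonneg_right ?_ (p 0)
    have : ratioU k lam ^ 2 ≤ 1 := pow_le_one₀ hup.le (by linarith)
    rw [pow_zero, mul_one]
    nlinarith

end HalfBounds

section FixedPoint

/-- The recurrence of `succ_mul_orderKCoeff` at `lam = n / d`, started at `c` and rounded down. -/
def fixedCoeff (k n d c : ℕ) : ℕ → ℕ
  | 0 => c
  | j + 1 => n * (∑ i : Fin k, if (i : ℕ) ≤ j then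
      ((i : ℕ) + 1) * fixedCoeff k n d c (j - i) else 0) / (d * (j + 1))

variable {k n d c : ℕ}

theorem succ_mul_orderKCoeff_succ (k : ℕ) (lam : ℝ) (j : ℕ) :
    (j + 1) * orderKCoeff k lam (j + 1) =
      lam * ∑ i : Fin k, if (i : ℕ) ≤ j then
        ((i : ℕ) + 1) * orderKCoeff k lam (j - i) else 0 := by
  have h := succ_mul_orderKCoeff k lam (j + 1)
  simpa using h

theorem fixedCoeff_succ_mul_le (hd : 0 < d) (j : ℕ) :
    ((j : ℝ) + 1) * fixedCoeff k n d c (j + 1) ≤ n / d * ∑ i : Fin k, if (i : ℕ) ≤ j then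
        ((i : ℕ) + 1) * (fixedCoeff k n d c (j - i) : ℝ) else 0 := by
  rw [fixedCoeff]
  have h := Nat.cast_div_le (α := ℝ) (m := n * (∑ i : Fin k, if (i : ℕ) ≤ j then
      ((i : ℕ) + 1) * fixedCoeff k n d c (j - i) else 0)) (n := d * (j + 1))
  push_cast at h ⊢
  rw [le_div_iff₀ (by positivity)] at h
  rw [div_mul_eq_mul_div, le_div_iff₀ (by positivity)]
  linarith

theorem le_fixedCoeff_succ_mul (hd : 0 < d) (j : ℕ) :
    (n / d * ∑ i : Fin k, if (i : ℕ) ≤ j then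
        ((i : ℕ) + 1) * (fixedCoeff k n d c (j - i) : ℝ) else 0) ≤
      ((j : ℝ) + 1) * (fixedCoeff k n d c (j + 1) + 1) := by
  rw [fixedCoeff]
  have h := (Nat.lt_mul_div_succ (n * (∑ i : Fin k, if (i : ℕ) ≤ j then
      ((i : ℕ) + 1) * fixedCoeff k n d c (j - i) else 0))
      (by positivity : 0 < d * (j + 1))).le
  have h' := (Nat.cast_le (α := ℝ)).2 h
  push_cast at h' ⊢
  rw [div_mul_eq_mul_div, div_le_iff₀ (by positivity)]
  linarith

theorem fixedCoeff_le (hd : 0 < d) (j : ℕ) :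
    (fixedCoeff k n d c j : ℝ) ≤ c * orderKCoeff k (n / d) j := by
  induction j using Nat.strong_induction_on with
  | _ j ih =>
    cases j with
    | zero => simp [fixedCoeff, orderKCoeff_zero]
    | succ j =>
      refine le_of_mul_le_mul_left ((fixedCoeff_succ_mul_le hd j).trans ?_)
        (by positivity : (0 : ℝ) < (j : ℝ) + 1)
      rw [mul_left_comm, succ_mul_orderKCoeff_succ, mul_left_comm,
        Finset.mul_sum _ _ (c : ℝ)]
      gcongr with i
      split_ifs
      · rw [mul_left_comm]
        gcongr
        exact ih _ (by omega)
      · simp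

/-- Summed form of `succ_mul_orderKCoeff_succ`. -/
theorem sum_mul_orderKCoeff (k : ℕ) (lam : ℝ) (j : ℕ) :
    lam * (∑ i : Fin k, if (i : ℕ) ≤ j then
      ((i : ℕ) + 1) * ∑ l ∈ Finset.range (j - i + 1), orderKCoeff k lam l else 0) =
      ∑ l ∈ Finset.range (j + 2), l * orderKCoeff k lam l := by
  induction j with
  | zero =>
    have h := succ_mul_orderKCoeff_succ k lam 0
    simp [Finset.sum_range_succ] at h ⊢
    exact h.symm
  | succ j ih =>
    rw [Finset.sum_range_succ, ← ih]
    have h := succ_mul_orderKCoeff_succ k lam (j + 1)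
    push_cast at h ⊢
    rw [add_assoc (j : ℝ), one_add_one_eq_two] at h
    rw [show j + 2 = j + 1 + 1 from rfl, h, ← mul_add, ← Finset.sum_add_distrib]
    congr 1
    refine Finset.sum_congr rfl fun i _ => ?_
    rcases lt_trichotomy (i : ℕ) (j + 1) with hi | hi | hi
    · rw [if_pos hi.le, if_pos (by omega), if_pos hi.le, ← mul_add,
        show j + 1 - (i : ℕ) = j - i + 1 by omega, Finset.sum_range_succ _ (j - i + 1)]
    · rw [if_pos hi.le, if_neg (by omega), if_pos hi.le, hi]
      simp
    · rw [if_neg (by omega), if_neg (by omega), if_neg (by omega), add_zero]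

theorem le_fixedCoeff_add (hd : 0 < d) (j : ℕ) :
    c * orderKCoeff k (n / d) j ≤ fixedCoeff k n d c j +
      ∑ l ∈ Finset.range (j + 1), orderKCoeff k (n / d) l := by
  have hg : ∀ l, 0 ≤ orderKCoeff k ((n : ℝ) / d) l := orderKCoeff_nonneg k (by positivity)
  induction j using Nat.strong_induction_on with
  | _ j ih =>
    cases j with
    | zero => simp [fixedCoeff, orderKCoeff_zero]
    | succ j =>
      refine le_of_mul_le_mul_left ?_ (by positivity : (0 : ℝ) < (j : ℝ) + 1)
      have h1 : ((j : ℝ) + 1) * (c * orderKCoeff k (n / d) (j + 1)) ≤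
          (n / d * ∑ i : Fin k, if (i : ℕ) ≤ j then
            ((i : ℕ) + 1) * (fixedCoeff k n d c (j - i) : ℝ) else 0) +
          (n / d * ∑ i : Fin k, if (i : ℕ) ≤ j then ((i : ℕ) + 1) *
            ∑ l ∈ Finset.range (j - i + 1), orderKCoeff k (n / d) l else 0) := by
        rw [mul_left_comm, succ_mul_orderKCoeff_succ, mul_left_comm, Finset.mul_sum, ← mul_add,
          ← Finset.sum_add_distrib]
        gcongr with i
        split_ifs
        · rw [mul_left_comm, ← mul_add]
          gcongr
          exact ih _ (by omega)
        · simp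
      have h2 : (j : ℝ) + 1 + ∑ l ∈ Finset.range (j + 2), l * orderKCoeff k (n / d) l ≤
          ((j : ℝ) + 1) * ∑ l ∈ Finset.range (j + 2), orderKCoeff k (n / d) l := by
        rw [Finset.sum_range_succ', Finset.sum_range_succ' _ (j + 1), mul_add, orderKCoeff_zero,
          Finset.mul_sum]
        have : ∑ l ∈ Finset.range (j + 1), ((l + 1 : ℕ) : ℝ) * orderKCoeff k (n / d) (l + 1) ≤
            ∑ l ∈ Finset.range (j + 1), ((j : ℝ) + 1) * orderKCoeff k (n / d) (l + 1) := by
          refine Finset.sum_le_sum fun l hl => mul_le_mul_of_nonneg_right ?_ (hg _)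
          exact_mod_cast Finset.mem_range.1 hl
        simp only [Nat.cast_zero, add_zero, mul_one]
        linarith
      have h3 := le_fixedCoeff_succ_mul (k := k) (n := n) (c := c) hd j
      rw [sum_mul_orderKCoeff] at h1
      linarith

theorem sum_fixedCoeff_le (hd : 0 < d) (N : ℕ) :
    ((∑ j ∈ Finset.range N, fixedCoeff k n d c j : ℕ) : ℝ) ≤
      c * ∑ j ∈ Finset.range N, orderKCoeff k (n / d) j := by
  rw [Finset.mul_sum]
  push_cast
  exact Finset.sum_le_sum fun j _ => fixedCoeff_le hd j

theorem le_sum_fixedCoeff (hd : 0 < d) (N : ℕ) :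
    ((c : ℝ) - N) * ∑ j ∈ Finset.range N, orderKCoeff k (n / d) j ≤
      (∑ j ∈ Finset.range N, fixedCoeff k n d c j : ℕ) := by
  have h : c * ∑ j ∈ Finset.range N, orderKCoeff k (n / d) j ≤
      ∑ j ∈ Finset.range N, ((fixedCoeff k n d c j : ℝ) +
        ∑ l ∈ Finset.range N, orderKCoeff k (n / d) l) := by
    rw [Finset.mul_sum]
    refine Finset.sum_le_sum fun j hj => (le_fixedCoeff_add hd j).trans ?_
    gcongr
    · exact fun _ _ _ => orderKCoeff_nonneg k (by positivity) _
    · exact Finset.mem_range.1 hj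
  rw [Finset.sum_add_distrib, Finset.sum_const, Finset.card_range, nsmul_eq_mul] at h
  push_cast
  linarith

theorem orderKCoeff_le_exp (k : ℕ) {lam : ℝ} (hl : 0 ≤ lam) (j : ℕ) :
    orderKCoeff k lam j ≤ Real.exp (k * lam) := by
  have h := hasSum_orderKCoeff_real k lam 1
  simp only [one_pow, mul_one, Finset.sum_const, Finset.card_univ, Fintype.card_fin,
    nsmul_eq_mul] at h
  rw [mul_comm (k : ℝ)]
  exact le_hasSum h j fun _ _ => orderKCoeff_nonneg k hl _

end FixedPoint

section WindowRun

/-- `forced n f = f n`, arranged so that the kernel evaluates `n` before it is substituted. -/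
def forced {α : Type} (n : ℕ) (f : ℕ → α) : α :=
  Nat.rec (f 0) (fun m _ => f (Nat.succ m)) n

theorem forced_eq {α : Type} (n : ℕ) (f : ℕ → α) : forced n f = f n := by
  cases n <;> rfl

/-- Runs the recurrence of `fixedCoeff`. The last `k + 1` values are packed in base `w` into one
number, which is accompanied by their sum and their weighted sum, and by the sum of all values. -/
def windowRun (k1 n d sh w : ℕ) (P : ℕ → ℕ → Bool) (fuel : ℕ) : ℕ → ℕ → ℕ → ℕ → ℕ → Bool :=
  Nat.rec (fun _ W _ _ S => P (Nat.mod W w) S) (fun _ ih dj W A B S =>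
    forced (Nat.div W sh) fun y =>
    forced (Nat.sub B (Nat.mul k1 y)) fun B' =>
    forced (Nat.div (Nat.mul n B') dj) fun x =>
    forced (Nat.add (Nat.sub A y) x) fun A' =>
    ih (Nat.add dj d) (Nat.add (Nat.mul (Nat.mod W sh) w) x) A' (Nat.add B' A') (Nat.add S x)) fuel

theorem windowRun_succ (k1 n d sh w : ℕ) (P : ℕ → ℕ → Bool) (fuel dj W A B S : ℕ) :
    windowRun k1 n d sh w P (fuel + 1) dj W A B S =
      windowRun k1 n d sh w P fuel (dj + d)
        (W % sh * w + n * (B - k1 * (W / sh)) / dj)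
        (A - W / sh + n * (B - k1 * (W / sh)) / dj)
        (B - k1 * (W / sh) + (A - W / sh + n * (B - k1 * (W / sh)) / dj))
        (S + n * (B - k1 * (W / sh)) / dj) := by
  conv_lhs => rw [windowRun]
  dsimp only
  rw [forced_eq, forced_eq, forced_eq, forced_eq]
  rfl

/-- The value `i` steps before index `j`, or `0` if there is none. -/
def lagged (L : ℕ → ℕ) (j i : ℕ) : ℕ := if i ≤ j then L (j - i) else 0

theorem lagged_succ_succ (L : ℕ → ℕ) (j i : ℕ) : lagged L (j + 1) (i + 1) = lagged L j i := by
  simp [lagged]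

theorem lagged_zero (L : ℕ → ℕ) (j : ℕ) : lagged L j 0 = L j := by
  simp [lagged]

theorem sum_mul_pow_lt {w : ℕ} (a : ℕ → ℕ) (k : ℕ) (ha : ∀ i, a i < w) :
    ∑ i ∈ Finset.range k, a i * w ^ i < w ^ k := by
  induction k with
  | zero => simp
  | succ k ih =>
    rw [Finset.sum_range_succ, pow_succ']
    have := Nat.mul_le_mul_right (w ^ k) (Nat.succ_le_of_lt (ha k))
    rw [Nat.succ_mul] at this
    omega

theorem fixedCoeff_succ_eq (k n d c j : ℕ) :
    fixedCoeff k n d c (j + 1) = n * (∑ i ∈ Finset.range k,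
      (i + 1) * lagged (fixedCoeff k n d c) (j + 1) (i + 1)) / (d * (j + 1)) := by
  rw [fixedCoeff, ← Fin.sum_univ_eq_sum_range
    (fun i => (i + 1) * lagged (fixedCoeff k n d c) (j + 1) (i + 1))]
  simp [lagged]

theorem windowRun_eq (k n d c w : ℕ) (P : ℕ → ℕ → Bool) (fuel j : ℕ)
    (hb : ∀ l < j + 1 + fuel, fixedCoeff k n d c l < w) :
    windowRun (k + 1) n d (w ^ k) w P fuel (d * (j + 1))
      (∑ i ∈ Finset.range (k + 1), lagged (fixedCoeff k n d c) (j + 1) (i + 1) * w ^ i)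
      (∑ i ∈ Finset.range (k + 1), lagged (fixedCoeff k n d c) (j + 1) (i + 1))
      (∑ i ∈ Finset.range (k + 1), (i + 1) * lagged (fixedCoeff k n d c) (j + 1) (i + 1))
      (∑ l ∈ Finset.range (j + 1), fixedCoeff k n d c l) =
    P (fixedCoeff k n d c (j + fuel)) (∑ l ∈ Finset.range (j + fuel + 1), fixedCoeff k n d c l) := by
  have hw : 0 < w := (Nat.zero_le _).trans_lt (hb 0 (by omega))
  have hlag : ∀ i, lagged (fixedCoeff k n d c) (j + 1) (i + 1) < w := fun i => by
    rw [lagged]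
    split_ifs
    · exact hb _ (by omega)
    · exact hw
  induction fuel generalizing j with
  | zero =>
    change P (Nat.mod _ w) _ = _
    congr 1
    rw [Finset.sum_range_succ', pow_zero, mul_one, zero_add, lagged_succ_succ, lagged_zero]
    simp only [pow_succ, ← mul_assoc, ← Finset.sum_mul]
    change (_ * w + _) % w = _
    exact Nat.mul_add_mod_of_lt (hb _ (by omega))
  | succ fuel ih =>
    have hlt := sum_mul_pow_lt (w := w) (fun i => lagged (fixedCoeff k n d c) (j + 1) (i + 1)) k hlag
    rw [windowRun_succ]
    simp only [Finset.sum_range_succ _ k]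
    have hdiv : ((∑ i ∈ Finset.range k, lagged (fixedCoeff k n d c) (j + 1) (i + 1) * w ^ i) +
        lagged (fixedCoeff k n d c) (j + 1) (k + 1) * w ^ k) / w ^ k =
        lagged (fixedCoeff k n d c) (j + 1) (k + 1) := by
      rw [Nat.add_mul_div_right _ _ (by positivity), Nat.div_eq_of_lt hlt, zero_add]
    rw [hdiv, Nat.add_mul_mod_self_right, Nat.mod_eq_of_lt hlt, Nat.add_sub_cancel,
      Nat.add_sub_cancel, ← fixedCoeff_succ_eq]
    have ih' := ih (j + 1) (fun l hl => hb l (by omega)) (fun i => by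
      rw [lagged]
      split_ifs
      · exact hb _ (by omega)
      · exact hw)
    simp only [lagged_succ_succ _ (j + 1)] at ih'
    rw [Finset.sum_range_succ', Finset.sum_range_succ' (lagged _ _),
      Finset.sum_range_succ' (fun i => (i + 1) * _)] at ih'
    simp only [lagged_zero] at ih'
    rw [show j + (fuel + 1) = j + 1 + fuel by ring, ← ih', Finset.sum_range_succ _ (j + 1)]
    congr 1
    · simp only [pow_succ, Finset.sum_mul, mul_assoc, pow_zero, mul_one]
    · simp only [add_mul, one_mul, Finset.sum_add_distrib, zero_mul]
      ring

end WindowRun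

section FiniteCheck

/-- A fixed-point certificate that the median at mean `n` is `n - ⌊(k+4)/8⌋`. -/
def medianCheck (k n : ℕ) : Bool :=
  forced (k * (k + 1) / 2) fun d =>
  forced (n - (k + 4) / 8) fun ν =>
  forced ((2 ^ 96) ^ k) fun sh =>
  windowRun (k + 1) n d sh (2 ^ 96) (fun x S =>
    Nat.blt (27182818286 ^ (2 * n) * (2 ^ 48) ^ (k + 1))
      ((2 * S) ^ (k + 1) * (10 ^ 10) ^ (2 * n)) &&
    Nat.blt ((2 * (S - x)) ^ (k + 1) * (10 ^ 10) ^ (2 * n))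
      ((2 ^ 48 - ν) ^ (k + 1) * 27182818283 ^ (2 * n)))
    ν d (2 ^ 48) (2 ^ 48) (2 ^ 48) (2 ^ 48)

variable {k n : ℕ}

theorem windowRun_start (k n d c w : ℕ) (P : ℕ → ℕ → Bool) (fuel : ℕ)
    (hb : ∀ l < fuel + 1, fixedCoeff k n d c l < w) :
    windowRun (k + 1) n d (w ^ k) w P fuel d c c c c =
      P (fixedCoeff k n d c fuel) (∑ l ∈ Finset.range (fuel + 1), fixedCoeff k n d c l) := by
  have h := windowRun_eq k n d c w P fuel 0 fun l hl => hb l (by omega)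
  have h0 : fixedCoeff k n d c 0 = c := by rw [fixedCoeff]
  have hz : ∀ i, lagged (fixedCoeff k n d c) (0 + 1) (i + 1 + 1) = 0 := fun i => by simp [lagged]
  simp only [Finset.sum_range_succ', hz] at h
  simpa [lagged_zero, lagged_succ_succ, h0, Finset.sum_range_succ'] using h

theorem two_mul_half (k : ℕ) : (2 : ℝ) * ((k * (k + 1) / 2 : ℕ) : ℝ) = k * (k + 1) := by
  have h : 2 * (k * (k + 1) / 2) = k * (k + 1) :=
    Nat.mul_div_cancel' (Nat.even_mul_succ_self k).two_dvd
  exact_mod_cast h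

theorem triangle_pos (hk : 0 < k) : 0 < k * (k + 1) / 2 :=
  Nat.div_pos (by nlinarith) (by norm_num)

theorem order_mul_mean (hk : 0 < k) :
    (k : ℝ) * (n / (k * (k + 1) / 2 : ℕ)) = 2 * n / (k + 1) := by
  have h := two_mul_half k
  have hd : (0 : ℝ) < (k * (k + 1) / 2 : ℕ) := by exact_mod_cast triangle_pos hk
  have hk' : (0 : ℝ) < k := by exact_mod_cast hk
  rw [mul_div_assoc', div_eq_div_iff hd.ne' (by positivity)]
  linear_combination -(n : ℝ) * h

theorem exp_mean_pow (k n : ℕ) :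
    Real.exp (2 * n / (k + 1)) ^ (k + 1) = Real.exp 1 ^ (2 * n) := by
  rw [← Real.exp_nat_mul, ← Real.exp_nat_mul]
  congr 1
  push_cast
  field_simp

theorem cdf_bounds_of_medianCheck (hk : 0 < k) (hn : n ≤ 14 * (k + 1)) (hn' : n < 2 ^ 48)
    (h : medianCheck k n = true) :
    1 / 2 < ∑ j ∈ Finset.range (n - (k + 4) / 8 + 1),
        poissonOrderKPmf k (n / (k * (k + 1) / 2 : ℕ)) j ∧
      ∑ j ∈ Finset.range (n - (k + 4) / 8),
        poissonOrderKPmf k (n / (k * (k + 1) / 2 : ℕ)) j < 1 / 2 := by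
  have hd : 0 < k * (k + 1) / 2 := triangle_pos hk
  have he := order_mul_mean (n := n) hk
  simp only [poissonOrderKPmf_eq, ← Finset.mul_sum, he]
  have hk1 : (0 : ℝ) < k + 1 := by positivity
  simp only [medianCheck, forced_eq] at h
  generalize k * (k + 1) / 2 = d at *
  have hν : n - (k + 4) / 8 ≤ n := Nat.sub_le _ _
  generalize n - (k + 4) / 8 = ν at *
  have hb : ∀ l < ν + 1, fixedCoeff k n d (2 ^ 48) l < 2 ^ 96 := fun l _ => by
    have h1 := (fixedCoeff_le (k := k) (n := n) (c := 2 ^ 48) hd l).trans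
      (mul_le_mul_of_nonneg_left (orderKCoeff_le_exp k (by positivity) l) (by positivity))
    rw [he] at h1
    have h2 : Real.exp (2 * n / (k + 1)) < 2 ^ 48 := by
      have h3 : (2 : ℝ) * n / (k + 1) ≤ (28 : ℕ) := by
        rw [div_le_iff₀ hk1]
        have : (n : ℝ) ≤ 14 * (k + 1) := by exact_mod_cast hn
        push_cast
        linarith
      calc _ ≤ Real.exp 1 ^ 28 := by
            rw [← Real.exp_nat_mul, mul_one]
            exact Real.exp_le_exp.2 h3
        _ ≤ 2.7182818286 ^ 28 := pow_le_pow_left₀ (Real.exp_pos _).le Real.exp_one_lt_d9.le _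
        _ < 2 ^ 48 := by norm_num
    have h4 : (fixedCoeff k n d (2 ^ 48) l : ℝ) < ((2 ^ 96 : ℕ) : ℝ) := by
      refine h1.trans_lt ?_
      push_cast
      linarith
    exact_mod_cast h4
  rw [windowRun_start _ _ _ _ _ _ _ hb, Bool.and_eq_true, Nat.blt_eq, Nat.blt_eq,
    Finset.sum_range_succ, Nat.add_sub_cancel, ← Finset.sum_range_succ] at h
  obtain ⟨h1, h2⟩ := h
  have hS := sum_fixedCoeff_le (k := k) (n := n) (c := 2 ^ 48) hd (ν + 1)
  have hS' := le_sum_fixedCoeff (k := k) (n := n) (c := 2 ^ 48) hd ν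
  generalize ∑ j ∈ Finset.range (ν + 1), fixedCoeff k n d (2 ^ 48) j = S at h1 hS
  generalize ∑ j ∈ Finset.range ν, fixedCoeff k n d (2 ^ 48) j = S' at h2 hS'
  generalize ∑ j ∈ Finset.range (ν + 1), orderKCoeff k (n / d) j = G at hS ⊢
  generalize ∑ j ∈ Finset.range ν, orderKCoeff k (n / d) j = G' at hS' ⊢
  have hexp := exp_mean_pow k n
  have hexp0 := Real.exp_pos (2 * n / (k + 1))
  rw [Real.exp_neg]
  generalize Real.exp (2 * n / (k + 1)) = e at hexp hexp0 ⊢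
  have hνc : (0 : ℝ) < 2 ^ 48 - ν := by
    have : (ν : ℝ) < 2 ^ 48 := by exact_mod_cast hν.trans_lt hn'
    linarith
  rw [← div_eq_inv_mul, ← div_eq_inv_mul, lt_div_iff₀ hexp0, div_lt_iff₀ hexp0]
  push_cast at hS hS'
  constructor
  · have h3 : (2 ^ 48 * e) ^ (k + 1) < (2 * (S : ℝ)) ^ (k + 1) := by
      have h1' := (Nat.cast_lt (α := ℝ)).2 h1
      simp only [Nat.cast_mul, Nat.cast_pow, Nat.cast_ofNat] at h1'
      have h4 : Real.exp 1 ^ (2 * n) * (10 ^ 10) ^ (2 * n) ≤ 27182818286 ^ (2 * n) := by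
        rw [← mul_pow]
        exact pow_le_pow_left₀ (by positivity) (by linarith [Real.exp_one_lt_d9]) _
      refine lt_of_mul_lt_mul_right (lt_of_le_of_lt ?_ h1') (by positivity)
      rw [mul_pow, hexp, mul_assoc, mul_comm (27182818286 ^ _)]
      exact mul_le_mul_of_nonneg_left h4 (by positivity)
    have := lt_of_pow_lt_pow_left₀ _ (by positivity) h3
    linarith
  · have h3 : (2 * (S' : ℝ)) ^ (k + 1) < ((2 ^ 48 - ν) * e) ^ (k + 1) := by
      have h2' := (Nat.cast_lt (α := ℝ)).2 h2
      simp only [Nat.cast_mul, Nat.cast_pow, Nat.cast_ofNat,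
        Nat.cast_sub (hν.trans hn'.le)] at h2'
      have h4 : (27182818283 : ℝ) ^ (2 * n) ≤ Real.exp 1 ^ (2 * n) * (10 ^ 10) ^ (2 * n) := by
        rw [← mul_pow]
        exact pow_le_pow_left₀ (by positivity) (by linarith [Real.exp_one_gt_d9]) _
      refine lt_of_mul_lt_mul_right (h2'.trans_le ?_) (by positivity)
      rw [mul_pow, hexp, mul_assoc]
      exact mul_le_mul_of_nonneg_left h4 (by positivity)
    have := lt_of_pow_lt_pow_left₀ _ (by positivity) h3
    have h4 : (2 ^ 48 - ν) * (2 * G') < (2 ^ 48 - ν) * e := by linarith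
    have := lt_of_mul_lt_mul_left h4 hνc.le
    linarith

end FiniteCheck

section FiniteRange

/-- `medianCheck` for all means from `k(k+1)/2` to `14(k+1)`. -/
def medianCheckRange (k : ℕ) : Bool :=
  (List.range (14 * (k + 1) + 1 - k * (k + 1) / 2)).all fun j =>
    medianCheck k (k * (k + 1) / 2 + j)

set_option maxRecDepth 100000 in
theorem medianCheckRange_eq_true {k : ℕ} (hk : 2 ≤ k) (hk' : k ≤ 27) :
    medianCheckRange k = true := by
  interval_cases k <;> decide +kernel

theorem cdf_bounds_of_le {k n : ℕ} (hk : 2 ≤ k) (hk' : k ≤ 27) (hn : k * (k + 1) / 2 ≤ n)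
    (hn' : n ≤ 14 * (k + 1)) :
    1 / 2 < ∑ j ∈ Finset.range (n - (k + 4) / 8 + 1),
        poissonOrderKPmf k (n / (k * (k + 1) / 2 : ℕ)) j ∧
      ∑ j ∈ Finset.range (n - (k + 4) / 8),
        poissonOrderKPmf k (n / (k * (k + 1) / 2 : ℕ)) j < 1 / 2 := by
  have h := medianCheckRange_eq_true hk hk'
  rw [medianCheckRange, List.all_eq_true] at h
  have := h (n - k * (k + 1) / 2) (List.mem_range.2 (by omega))
  rw [Nat.add_sub_cancel' hn] at this
  exact cdf_bounds_of_medianCheck (by omega) hn' (by omega) this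

end FiniteRange

section Assembly

variable {k n : ℕ}

theorem exists_cdf_eq_half {ν : ℕ} {a b : ℝ} (hab : a ≤ b)
    (ha : 1 / 2 < ∑ j ∈ Finset.range (ν + 1), poissonOrderKPmf k a j)
    (hb : ∑ j ∈ Finset.range (ν + 1), poissonOrderKPmf k b j < 1 / 2) :
    ∃ lam, a < lam ∧ lam < b ∧
      ∑ j ∈ Finset.range (ν + 1), poissonOrderKPmf k lam j = 1 / 2 := by
  obtain ⟨lam, ⟨h1, h2⟩, h⟩ :=
    intermediate_value_Ioo' hab (continuous_cdf k ν).continuousOn ⟨hb, ha⟩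
  exact ⟨lam, h1, h2, h⟩

theorem skewC_eq (k : ℕ) : skewC k = k * (k + 1) / (4 * (2 * k + 1)) := by
  rw [skewC]
  field_simp
  ring

theorem skewC_mul_ratioU (hk : 0 < k) {lam : ℝ} (hl : 0 < lam) :
    skewC k * ratioU k lam = 3 / (2 * lam) := by
  have h : (0 : ℝ) < (2 * k + 1) ^ 2 - 1 := by
    have : (0 : ℝ) < k := by exact_mod_cast hk
    nlinarith
  rw [skewC, ratioU]
  field_simp
  norm_num

theorem le_skewC (hk : 2 ≤ k) : (((k + 4) / 8 : ℕ) : ℝ) + 0.05 ≤ skewC k + 1 / 2 := by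
  have hk' : (2 : ℝ) ≤ k := by exact_mod_cast hk
  have h : (((k + 4) / 8 : ℕ) : ℝ) ≤ (k + 4) / 8 := by
    rw [le_div_iff₀ (by norm_num)]
    exact_mod_cast Nat.div_mul_le_self (k + 4) 8
  have : (k : ℝ) / 8 + 0.05 ≤ skewC k := by
    rw [skewC_eq, le_div_iff₀ (by positivity)]
    nlinarith
  linarith

theorem skewC_lt (k : ℕ) : skewC k + 1 / 2 + 1 / 16 < (((k + 4) / 8 : ℕ) : ℝ) + 1 := by
  have h : ((k : ℝ) + 4) ≤ 8 * (((k + 4) / 8 : ℕ) : ℝ) + 7 := by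
    have : k + 4 ≤ 8 * ((k + 4) / 8) + 7 := by omega
    exact_mod_cast this
  have : skewC k < (k : ℝ) / 8 + 1 / 16 := by
    rw [skewC_eq, div_lt_iff₀ (by positivity)]
    nlinarith [(Nat.cast_nonneg k : (0 : ℝ) ≤ k)]
  linarith

theorem ratioU_le (hk : 2 ≤ k) {lam : ℝ} (hl : 0 < lam)
    (h : 14 * ((k : ℝ) + 1) ≤ (k * (k + 1) / 2 : ℕ) * lam) : ratioU k lam ≤ 3 / 7 := by
  have hd := two_mul_half k
  have h24 := sq_sub_one_pos hk
  rw [ratioU, div_le_iff₀ (by positivity)]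
  have : ((2 * (k : ℝ) + 1) ^ 2 - 1) * lam = 8 * ((k * (k + 1) / 2 : ℕ) * lam) := by
    linear_combination -4 * lam * hd
  rw [this]
  linarith

theorem exists_of_large (hk : 2 ≤ k) (hn : k * (k + 1) / 2 ≤ n) (hn' : 14 * (k + 1) ≤ n) :
    ∃ lam : ℝ, (n : ℝ) < (k * (k + 1) / 2 : ℕ) * lam ∧
      (k * (k + 1) / 2 : ℕ) * lam < (n : ℝ) + 1 ∧
      ∑ j ∈ Finset.range (n - (k + 4) / 8 + 1), poissonOrderKPmf k lam j = 1 / 2 := by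
  have hd0 := triangle_pos (k := k) (by omega)
  have h2d := two_mul_half k
  have hc1 := le_skewC hk
  have hc2 := skewC_lt k
  have hu : ∀ lam : ℝ, 0 < lam → (n : ℝ) ≤ (k * (k + 1) / 2 : ℕ) * lam →
      ratioU k lam ≤ 3 / 7 := fun lam hl h =>
    ratioU_le hk hl (le_trans (by exact_mod_cast hn') h)
  have hcu : ∀ lam : ℝ, 0 < lam → _ := fun lam hl => skewC_mul_ratioU (k := k) (by omega) hl
  have hn42 : (42 : ℝ) ≤ n := by
    have : 42 ≤ n := by omega
    exact_mod_cast this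
  have hν : ((n - (k + 4) / 8 : ℕ) : ℝ) = n - ((k + 4) / 8 : ℕ) :=
    Nat.cast_sub (by omega)
  generalize n - (k + 4) / 8 = ν at *
  generalize (k + 4) / 8 = fl at *
  generalize k * (k + 1) / 2 = d at *
  have hd : (0 : ℝ) < d := by exact_mod_cast hd0
  have hdn : (d : ℝ) ≤ n := by exact_mod_cast hn
  have hμ : (d : ℝ) / n ≤ 1 := (div_le_one (by linarith)).2 hdn
  have hμ0 : 0 < (d : ℝ) / n := div_pos hd (by linarith)
  have hone : ∀ lam : ℝ, (n : ℝ) ≤ d * lam → 1 ≤ lam := fun lam h => by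
    by_contra! hc
    nlinarith
  obtain ⟨a, ha⟩ : ∃ a : ℝ, d * a = ν + 1 / 2 + skewC k - 0.05 * (d / n) :=
    ⟨_ / d, mul_div_cancel₀ _ hd.ne'⟩
  obtain ⟨b, hb⟩ : ∃ b : ℝ, d * b = ν + 1 / 2 + skewC k + 1 / 16 * (d / n) :=
    ⟨_ / d, mul_div_cancel₀ _ hd.ne'⟩
  have han : (n : ℝ) ≤ d * a := by linarith
  have hbn : (n : ℝ) ≤ d * b := by linarith
  have hb1 : d * b < n + 1 := by linarith
  have ha1 : d * a < n + 1 := by linarith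
  have hs : ∀ t : ℝ, (n : ℝ) ≤ d * t → d * t < n + 1 → 1 ≤ d / n * t ∧ d / n * t ≤ 1.024 :=
    fun t h1 h2 => by
      rw [div_mul_eq_mul_div]
      constructor
      · rwa [one_le_div (by linarith)]
      · rw [div_le_iff₀ (by linarith)]
        linarith
  have hx : ∀ t s : ℝ, 1 ≤ t → skewC k * (s * (d / n * t) * ratioU k t) = 3 / 2 * s * (d / n) :=
    fun t s ht => by
      have := hcu t (by linarith)
      have ht' : t ≠ 0 := by linarith
      rw [mul_comm (s * _), ← mul_assoc, this]
      field_simp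
  obtain ⟨a1, a2⟩ := hs a han ha1
  obtain ⟨b1, b2⟩ := hs b hbn hb1
  have hFa := half_lt_cdf hk (hone a han) (hu a (by linarith [hone a han]) han) ν
    (h := 1 / 30 * (d / n * a)) (by linarith) (by linarith) (by
      rw [mul_sub (skewC k), mul_one, hx a _ (hone a han)]
      linear_combination ha - a / 2 * h2d)
  have hFb := cdf_lt_half hk (hone b hbn) (hu b (by linarith [hone b hbn]) hbn) ν
    (h := 1 / 24 * (d / n * b)) (by linarith) (by linarith) (by
      rw [mul_add (skewC k), mul_one, hx b _ (hone b hbn)]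
      linear_combination hb - b / 2 * h2d)
  have hab : a ≤ b := le_of_mul_le_mul_left (by linarith : d * a ≤ d * b) hd
  obtain ⟨lam, h1, h2, h⟩ := exists_cdf_eq_half hab hFa hFb
  exact ⟨lam, han.trans_lt (mul_lt_mul_of_pos_left h1 hd),
    (mul_lt_mul_of_pos_left h2 hd).trans hb1, h⟩

theorem exists_of_small (hk : 2 ≤ k) (hn : k * (k + 1) / 2 ≤ n) (hn' : n < 14 * (k + 1)) :
    ∃ lam : ℝ, (n : ℝ) < (k * (k + 1) / 2 : ℕ) * lam ∧
      (k * (k + 1) / 2 : ℕ) * lam < (n : ℝ) + 1 ∧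
      ∑ j ∈ Finset.range (n - (k + 4) / 8 + 1), poissonOrderKPmf k lam j = 1 / 2 := by
  have hk27 : k ≤ 27 := by
    by_contra! hc
    have : 28 * (k + 1) ≤ k * (k + 1) := Nat.mul_le_mul_right _ hc
    omega
  have ha := (cdf_bounds_of_le hk hk27 hn hn'.le).1
  have hb := (cdf_bounds_of_le hk hk27 (n := n + 1) (by omega) hn').2
  have hd : (0 : ℝ) < (k * (k + 1) / 2 : ℕ) := by exact_mod_cast triangle_pos (by omega)
  have hk2 : k ≤ k * (k + 1) / 2 := by
    rw [Nat.le_div_iff_mul_le (by norm_num)]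
    exact Nat.mul_le_mul_left k (by omega)
  rw [show n + 1 - (k + 4) / 8 = n - (k + 4) / 8 + 1 by omega] at hb
  obtain ⟨lam, h1, h2, h⟩ := exists_cdf_eq_half (by gcongr; simp) ha hb
  rw [div_lt_iff₀' hd] at h1
  rw [lt_div_iff₀' hd] at h2
  exact ⟨lam, h1, by exact_mod_cast h2, h⟩

end Assembly

/-- Conjecture: For k > 1 and an integer n ≥ κ, with ν = n − ⌊(k+4)/8⌋,
one has α_(k,n) − n ∈ (0,1): there exists λ > 0 with n < κλ < n + 1 such that
Σ_{j=0}^{ν} f_k(j;λ) = 1/2 exactly. -/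
theorem poissonOrderK_alpha_bounds (k n : ℕ) (hk : 1 < k) (hn : k * (k + 1) / 2 ≤ n) :
    ∃ lam : ℝ, 0 < lam ∧
      (n : ℝ) < ((k * (k + 1) / 2 : ℕ) : ℝ) * lam ∧
      ((k * (k + 1) / 2 : ℕ) : ℝ) * lam < (n : ℝ) + 1 ∧
      ∑ j ∈ Finset.range ((n - (k + 4) / 8) + 1), poissonOrderKPmf k lam j = 1 / 2 := by
  obtain ⟨lam, h1, h2, h⟩ := (lt_or_ge n (14 * (k + 1))).elim (exists_of_small hk hn)
    (exists_of_large hk hn)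
  exact ⟨lam, pos_of_mul_pos_right ((Nat.cast_nonneg n).trans_lt h1) (Nat.cast_nonneg _),
    h1, h2, h⟩
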